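/- arXiv:math/0006070 — 4 statements merged into one kernel-verified Lean document; each statement's English description precedes it below -/
import Mathlib

section
/- For ν > -1, the Bessel kernel has the integral representation: for all x, y > 0 with x ≠ y and n > 0, [J_ν(2√(nx)) √(ny) J_ν'(2√(ny)) - J_ν(2√(ny)) √(nx) J_ν'(2√(nx))]/(x - y) = n ∫_0^1 J_ν(2√(nxt)) J_ν(2√(nyt)) dt. -/
/-- The Bessel function of the first kind of order `ν`, for positive argument:
`J_ν(x) = ∑_{m≥0} (-1)^m / (m! Γ(m+ν+1)) (x/2)^{2m+ν}`. -/
noncomputable def besselJ (ν : ℝ) (x : ℝ) : ℝ :=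
  ∑' m : ℕ, (-1) ^ m / (Nat.factorial m * Real.Gamma ((m : ℝ) + ν + 1)) *
    (x / 2) ^ (2 * m) * (x / 2) ^ ν

/-- coefficients -/
noncomputable def bcoef (μ : ℝ) (m : ℕ) : ℝ :=
  (-1) ^ m / (Nat.factorial m * Real.Gamma ((m : ℝ) + μ + 1))

noncomputable def bE (μ : ℝ) (s : ℝ) : ℝ := ∑' m : ℕ, bcoef μ m * s ^ m

lemma bGamma_pos (μ : ℝ) (hμ : -1 < μ) (m : ℕ) : 0 < Real.Gamma ((m : ℝ) + μ + 1) := by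
  apply Real.Gamma_pos_of_pos
  have : (0 : ℝ) ≤ m := Nat.cast_nonneg m
  linarith

lemma bcoef_ne (μ : ℝ) (hμ : -1 < μ) (m : ℕ) : bcoef μ m ≠ 0 := by
  unfold bcoef
  have := bGamma_pos μ hμ m
  have : (Nat.factorial m : ℝ) ≠ 0 := by positivity
  apply div_ne_zero
  · exact pow_ne_zero _ (by norm_num)
  · positivity

lemma bcoef_succ (μ : ℝ) (m : ℕ) : ((m + 1 : ℕ) : ℝ) * bcoef μ (m + 1) = - bcoef (μ + 1) m := by
  unfold bcoef
  rw [Nat.factorial_succ, pow_succ]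
  have h : ((m + 1 : ℕ) : ℝ) + μ + 1 = (m : ℝ) + (μ + 1) + 1 := by push_cast; ring
  rw [h]
  push_cast
  have : (m : ℝ) + 1 ≠ 0 := by positivity
  have : (Nat.factorial m : ℝ) ≠ 0 := by positivity
  by_cases hg : Real.Gamma ((m : ℝ) + (μ + 1) + 1) = 0
  · simp [hg]
  · field_simp

lemma bcoef_shift (μ : ℝ) (hμ : -1 < μ) (m : ℕ) :
    bcoef μ m = ((m : ℝ) + μ + 1) * bcoef (μ + 1) m := by
  unfold bcoef
  have h : (m : ℝ) + (μ + 1) + 1 = ((m : ℝ) + μ + 1) + 1 := by ring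
  have h0 : (0 : ℝ) < (m : ℝ) + μ + 1 := by
    have : (0 : ℝ) ≤ m := Nat.cast_nonneg m
    linarith
  rw [h, Real.Gamma_add_one h0.ne']
  have := bGamma_pos μ hμ m
  have : (Nat.factorial m : ℝ) ≠ 0 := by positivity
  field_simp

lemma bsummable (μ : ℝ) (hμ : -1 < μ) (s : ℝ) : Summable (fun m => bcoef μ m * s ^ m) := by
  by_cases hs : s = 0
  · subst hs
    apply summable_of_ne_finset_zero (s := {0})
    intro b hb
    have : b ≠ 0 := by simpa using hb
    simp [this]
  apply summable_of_ratio_test_tendsto_lt_one (l := 0) (by norm_num)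
  · exact Filter.Eventually.of_forall fun m => mul_ne_zero (bcoef_ne μ hμ m) (pow_ne_zero _ hs)
  have key : ∀ m : ℕ, ‖bcoef μ (m + 1) * s ^ (m + 1)‖ / ‖bcoef μ m * s ^ m‖
      = (|s| * (1 / ((m : ℝ) + 1))) * ((m : ℝ) + (μ + 1))⁻¹ := by
    intro m
    have h0 : (0 : ℝ) < (m : ℝ) + μ + 1 := by
      have : (0 : ℝ) ≤ m := Nat.cast_nonneg m
      linarith
    have h1 := bcoef_succ μ m
    have h2 := bcoef_shift μ hμ m
    have h3 := bcoef_ne (μ + 1) (by linarith) m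
    have hm : (0 : ℝ) < (m : ℝ) + 1 := by positivity
    have h4 : bcoef μ (m + 1) = - bcoef (μ + 1) m / ((m : ℝ) + 1) := by
      rw [eq_div_iff hm.ne', ← h1]; push_cast; ring
    rw [h4, h2, ← norm_div]
    have h5 : -bcoef (μ + 1) m / ((m : ℝ) + 1) * s ^ (m + 1) /
        (((m : ℝ) + μ + 1) * bcoef (μ + 1) m * s ^ m)
        = - (s * (1 / ((m : ℝ) + 1)) * ((m : ℝ) + (μ + 1))⁻¹) := by
      have : (m : ℝ) + (μ + 1) ≠ 0 := by linarith
      rw [← add_assoc] at *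
      field_simp
      ring
    have h6 : (0 : ℝ) < (m : ℝ) + (μ + 1) := by linarith
    rw [h5, norm_neg, norm_mul, norm_mul, Real.norm_eq_abs, Real.norm_eq_abs, Real.norm_eq_abs,
      abs_of_pos (inv_pos.mpr h6), abs_of_pos (one_div_pos.mpr hm)]
  simp_rw [key]
  have t1 : Filter.Tendsto (fun m : ℕ => |s| * (1 / ((m : ℝ) + 1))) Filter.atTop (nhds (|s| * 0)) :=
    tendsto_one_div_add_atTop_nhds_zero_nat.const_mul _
  have t2 : Filter.Tendsto (fun m : ℕ => ((m : ℝ) + (μ + 1))⁻¹) Filter.atTop (nhds 0) :=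
    (Filter.tendsto_atTop_add_const_right _ _ tendsto_natCast_atTop_atTop).inv_tendsto_atTop
  simpa using t1.mul t2

lemma bE_hasDerivAt (μ : ℝ) (hμ : -1 < μ) (s : ℝ) : HasDerivAt (bE μ) (- bE (μ + 1) s) s := by
  have hR : (0 : ℝ) < |s| + 1 := by positivity
  have hsum : Summable (fun m : ℕ => |(m : ℝ) * bcoef μ m| * (|s| + 1) ^ (m - 1)) := by
    rw [← summable_nat_add_iff 1]
    have := (bsummable (μ + 1) (by linarith) (|s| + 1)).abs
    refine this.congr ?_
    intro m
    rw [bcoef_succ, abs_neg, abs_mul, abs_of_pos (pow_pos hR m)]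
    simp
  have hd := hasDerivAt_tsum_of_isPreconnected (𝕜 := ℝ) (t := Metric.ball (0 : ℝ) (|s| + 1))
    (g := fun m z => bcoef μ m * z ^ m)
    (g' := fun m z => ((m : ℝ) * bcoef μ m) * z ^ (m - 1)) (y₀ := 0) (y := s)
    hsum Metric.isOpen_ball (convex_ball _ _).isPreconnected
    (fun m z _ => by
      have := (hasDerivAt_pow m z).const_mul (bcoef μ m)
      refine this.congr_deriv ?_
      ring)
    (fun m z hz => by
      rw [norm_mul, norm_pow, Real.norm_eq_abs]
      have : ‖z‖ ≤ |s| + 1 := by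
        have := mem_ball_zero_iff.mp hz
        exact this.le
      gcongr)
    (by simpa using hR) (bsummable μ hμ 0) (by simp)
  have e : ∑' m : ℕ, ((m : ℝ) * bcoef μ m) * s ^ (m - 1) = - bE (μ + 1) s := by
    have hs2 : Summable (fun m : ℕ => ((m : ℝ) * bcoef μ m) * s ^ (m - 1)) := by
      rw [← summable_nat_add_iff 1]
      refine ((bsummable (μ + 1) (by linarith) s).neg).congr ?_
      intro m
      rw [bcoef_succ]
      simp
    rw [hs2.tsum_eq_zero_add]
    unfold bE
    rw [← tsum_neg]
    simp only [bcoef_succ]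
    simp
  rw [← e]
  exact hd

lemma bE_ode (μ : ℝ) (hμ : -1 < μ) (s : ℝ) :
    s * bE (μ + 1 + 1) s = (μ + 1) * bE (μ + 1) s - bE μ s := by
  have S0 := bsummable μ hμ s
  have S1 := bsummable (μ + 1) (by linarith) s
  unfold bE
  rw [← tsum_mul_left (a := μ + 1), ← (S1.mul_left (μ + 1)).tsum_sub S0,
    ((S1.mul_left (μ + 1)).sub S0).tsum_eq_zero_add, ← tsum_mul_left]
  have z : (μ + 1) * (bcoef (μ + 1) 0 * s ^ 0) - bcoef μ 0 * s ^ 0 = 0 := by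
    rw [bcoef_shift μ hμ 0]; simp
  rw [z, zero_add]
  congr 1
  ext m
  have h1 := bcoef_succ (μ + 1) m
  rw [bcoef_shift μ hμ (m + 1)]
  have : bcoef (μ + 1 + 1) m = - (((m + 1 : ℕ) : ℝ) * bcoef (μ + 1) (m + 1)) := by
    rw [h1]; ring
  rw [this]; ring

lemma besselJ_eq (ν : ℝ) (z : ℝ) : besselJ ν z = bE ν ((z / 2) ^ 2) * (z / 2) ^ ν := by
  unfold besselJ bE bcoef
  rw [tsum_mul_right]
  simp only [pow_mul]

lemma besselJ_sqrt (ν : ℝ) (s : ℝ) (hs : 0 ≤ s) :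
    besselJ ν (2 * Real.sqrt s) = bE ν s * s ^ (ν / 2) := by
  rw [besselJ_eq, mul_div_cancel_left₀ _ (two_ne_zero), Real.sq_sqrt hs, Real.sqrt_eq_rpow,
    ← Real.rpow_mul hs]
  congr 2; ring

lemma besselJ_deriv (ν : ℝ) (hν : -1 < ν) (s : ℝ) (hs : 0 < s) :
    Real.sqrt s * deriv (besselJ ν) (2 * Real.sqrt s)
      = (ν / 2 * bE ν s - s * bE (ν + 1) s) * s ^ (ν / 2) := by
  have hq : 0 < Real.sqrt s := Real.sqrt_pos.mpr hs
  have e2 : 2 * Real.sqrt s / 2 = Real.sqrt s := mul_div_cancel_left₀ _ (two_ne_zero)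
  have hh : HasDerivAt (fun z : ℝ => z / 2) (1 / 2) (2 * Real.sqrt s) :=
    (hasDerivAt_id _).div_const 2
  have h1 := (bE_hasDerivAt ν hν ((2 * Real.sqrt s / 2) ^ 2)).comp (2 * Real.sqrt s) (hh.pow 2)
  have h2 := hh.rpow_const (p := ν) (Or.inl (by rw [e2]; exact hq.ne'))
  have h3 := h1.mul h2
  have hJ : besselJ ν = (bE ν ∘ ((fun z : ℝ => z / 2) ^ 2)) * fun z => (z / 2) ^ ν := by
    ext z; simp [besselJ_eq]
  rw [hJ, h3.deriv]
  simp only [Function.comp, Pi.pow_apply, e2, Real.sq_sqrt hs.le]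
  have e3 : Real.sqrt s ^ ν = s ^ (ν / 2) := by
    rw [Real.sqrt_eq_rpow, ← Real.rpow_mul hs.le]; congr 1; ring
  rw [Real.rpow_sub_one hq.ne', e3]
  have := Real.sq_sqrt hs.le
  field_simp
  simp only [Nat.cast_ofNat, Nat.add_one_sub_one, pow_one]
  linear_combination (-2 * bE (ν + 1) s) * this

lemma bint (ν : ℝ) (hν : -1 < ν) (a b : ℝ) :
    ∫ t in (0 : ℝ)..1, t ^ ν * ((a - b) * bE ν (a * t) * bE ν (b * t))
      = a * bE ν b * bE (ν + 1) a - b * bE ν a * bE (ν + 1) b := by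
  have hd : ∀ μ : ℝ, -1 < μ → ∀ c t : ℝ,
      HasDerivAt (fun t => bE μ (c * t)) (- bE (μ + 1) (c * t) * c) t := by
    intro μ hμ c t
    have h : HasDerivAt (fun t : ℝ => c * t) c t := by
      simpa using (hasDerivAt_id t).const_mul c
    exact (bE_hasDerivAt μ hμ (c * t)).comp t h
  have hc : ∀ μ : ℝ, -1 < μ → ∀ c : ℝ, Continuous (fun t => bE μ (c * t)) := fun μ hμ c =>
    continuous_iff_continuousAt.mpr fun t => (hd μ hμ c t).continuousAt
  have hν1 : -1 < ν + 1 := by linarith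
  have c1 := hc ν hν a
  have c2 := hc ν hν b
  have c3 := hc (ν + 1) hν1 a
  have c4 := hc (ν + 1) hν1 b
  have := intervalIntegral.integral_eq_sub_of_hasDerivAt_of_le (a := 0) (b := 1) (by norm_num)
    (f := fun t => t ^ (ν + 1) * (a * (bE ν (b * t) * bE (ν + 1) (a * t))
      - b * (bE ν (a * t) * bE (ν + 1) (b * t))))
    (f' := fun t => t ^ ν * ((a - b) * bE ν (a * t) * bE ν (b * t)))
    (by
      apply Continuous.continuousOn
      apply Continuous.mul
      · exact Real.continuous_rpow_const (by linarith)
      · fun_prop)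
    (by
      intro t ht
      have h0 : t ≠ 0 := ht.1.ne'
      have r := Real.hasDerivAt_rpow_const (p := ν + 1) (Or.inl h0)
      have q := ((((hd ν hν b t).mul (hd (ν + 1) hν1 a t)).const_mul a).sub
        (((hd ν hν a t).mul (hd (ν + 1) hν1 b t)).const_mul b))
      refine (r.mul q).congr_deriv ?_
      have oa := bE_ode ν hν (a * t)
      have ob := bE_ode ν hν (b * t)
      rw [add_sub_cancel_right, Real.rpow_add_one h0]
      simp only [Pi.sub_apply, Pi.mul_apply]
      linear_combination (-(t ^ ν) * a * bE ν (b * t)) * oa + (t ^ ν * b * bE ν (a * t)) * ob)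
    (by
      apply IntervalIntegrable.mul_continuousOn
      · exact intervalIntegral.intervalIntegrable_rpow' hν
      · apply Continuous.continuousOn
        fun_prop)
  rw [this]
  have : ν + 1 ≠ 0 := by linarith
  simp [Real.zero_rpow this]
  ring

/-- the integral representation of the Bessel kernel:
`[J_ν(2√(nx))√(ny)J_ν'(2√(ny)) - J_ν(2√(ny))√(nx)J_ν'(2√(nx))]/(x-y)
  = n ∫₀¹ J_ν(2√(nxt)) J_ν(2√(nyt)) dt`. -/
theorem stmt_9 (ν : ℝ) (hν : -1 < ν) (n : ℝ) (hn : 0 < n) (x y : ℝ)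
    (hx : 0 < x) (hy : 0 < y) (hxy : x ≠ y) :
    (besselJ ν (2 * Real.sqrt (n * x)) * Real.sqrt (n * y) *
          deriv (besselJ ν) (2 * Real.sqrt (n * y)) -
        besselJ ν (2 * Real.sqrt (n * y)) * Real.sqrt (n * x) *
          deriv (besselJ ν) (2 * Real.sqrt (n * x))) / (x - y)
      = n * ∫ t in (0 : ℝ)..1,
          besselJ ν (2 * Real.sqrt (n * x * t)) * besselJ ν (2 * Real.sqrt (n * y * t)) := by
  have ha : 0 < n * x := mul_pos hn hx
  have hb : 0 < n * y := mul_pos hn hy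
  have hI : ∫ t in (0 : ℝ)..1,
      besselJ ν (2 * Real.sqrt (n * x * t)) * besselJ ν (2 * Real.sqrt (n * y * t))
      = ∫ t in (0 : ℝ)..1, ((n * x) ^ (ν / 2) * (n * y) ^ (ν / 2) / (n * x - n * y)) *
        (t ^ ν * ((n * x - n * y) * bE ν (n * x * t) * bE ν (n * y * t))) := by
    apply intervalIntegral.integral_congr_ae
    refine Filter.Eventually.of_forall fun t ht => ?_
    rw [Set.uIoc_of_le (by norm_num)] at ht
    have h0 : 0 < t := ht.1
    have hne : n * x - n * y ≠ 0 := by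
      rw [← mul_sub]; exact mul_ne_zero hn.ne' (sub_ne_zero.mpr hxy)
    have ht2 : t ^ ν = t ^ (ν / 2) * t ^ (ν / 2) := by
      rw [← Real.rpow_add h0]; congr 1; ring
    rw [besselJ_sqrt _ _ (by positivity), besselJ_sqrt _ _ (by positivity),
      Real.mul_rpow ha.le h0.le, Real.mul_rpow hb.le h0.le, ht2]
    generalize n * x - n * y = d at *
    field_simp
  rw [hI, intervalIntegral.integral_const_mul, bint ν hν]
  have d1 := besselJ_deriv ν hν (n * x) ha
  have d2 := besselJ_deriv ν hν (n * y) hb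
  rw [mul_assoc, mul_assoc, d1, d2, besselJ_sqrt _ _ ha.le, besselJ_sqrt _ _ hb.le, ← mul_sub]
  have hne : x - y ≠ 0 := sub_ne_zero.mpr hxy
  field_simp
  ring
end

section
/- For ν ≥ -1/2, the Bessel function satisfies J_ν(z) = √(2/(πz)) cos(z - (ν/2 + 1/4)π) + O(z^{-1/2}/⟨z⟩) uniformly for z > 0, where ⟨z⟩ = (1+z²)^{1/2}. -/
noncomputable def bT (ν x : ℝ) (m : ℕ) : ℝ :=
  (-1) ^ m / (Nat.factorial m * Real.Gamma ((m : ℝ) + ν + 1)) * (x / 2) ^ (2 * m)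

lemma besselJ_eq_s10 (ν x : ℝ) : besselJ ν x = (∑' m, bT ν x m) * (x / 2) ^ ν := by
  unfold besselJ bT
  rw [tsum_mul_right]

lemma bT_succ (ν x : ℝ) (hν : -1 < ν) (m : ℕ) :
    bT ν x (m + 1) = bT ν x m * (-(x / 2) ^ 2 / ((m + 1) * (m + ν + 1))) := by
  have hp : 0 < (m : ℝ) + ν + 1 := by have : (0:ℝ) ≤ m := Nat.cast_nonneg m; linarith
  have hG : Real.Gamma (((m + 1 : ℕ) : ℝ) + ν + 1) = (m + ν + 1) * Real.Gamma (m + ν + 1) := by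
    rw [← Real.Gamma_add_one hp.ne']; congr 1; push_cast; ring
  have hG0 := (Real.Gamma_pos_of_pos hp).ne'
  have : (m : ℝ) + 1 ≠ 0 := by positivity
  have := hp.ne'
  unfold bT
  rw [hG, Nat.factorial_succ]
  push_cast
  field_simp
  ring

lemma bT_summable (ν x : ℝ) (hν : -1 < ν) : Summable (bT ν x) := by
  refine summable_of_ratio_norm_eventually_le (r := 1 / 2) (by norm_num) ?_
  have ht : Filter.Tendsto (fun m : ℕ => (m : ℝ) + ν + 1) Filter.atTop Filter.atTop :=
    Filter.tendsto_atTop_add_const_right _ _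
      (Filter.tendsto_atTop_add_const_right _ _ tendsto_natCast_atTop_atTop)
  filter_upwards [ht.eventually_ge_atTop (2 * (x / 2) ^ 2), ht.eventually_gt_atTop 0] with m hm hm0
  rw [bT_succ ν x hν, norm_mul, mul_comm]
  refine mul_le_mul_of_nonneg_right ?_ (norm_nonneg _)
  have h1 : (1:ℝ) ≤ m + 1 := by have : (0:ℝ) ≤ m := Nat.cast_nonneg m; linarith
  rw [Real.norm_eq_abs, abs_div, abs_neg, abs_of_nonneg (sq_nonneg _),
    abs_of_pos (by positivity), div_le_iff₀ (by positivity)]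
  nlinarith

lemma bT_rec (ν x : ℝ) (hν : -1 < ν) :
    (∑' m, bT ν x m) + (x / 2) ^ 2 * (∑' m, bT (ν + 2) x m) =
      (ν + 1) * ∑' m, bT (ν + 1) x m := by
  have s0 := bT_summable ν x hν
  have s1 := bT_summable (ν + 1) x (by linarith)
  have s2 := (bT_summable (ν + 2) x (by linarith)).mul_left ((x / 2) ^ 2)
  have e0 : ∀ m : ℕ, bT ν x m = (m + ν + 1) * bT (ν + 1) x m := by
    intro m
    have hp : 0 < (m : ℝ) + ν + 1 := by have : (0:ℝ) ≤ m := Nat.cast_nonneg m; linarith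
    have hG : Real.Gamma ((m : ℝ) + (ν + 1) + 1) = (m + ν + 1) * Real.Gamma (m + ν + 1) := by
      rw [← Real.Gamma_add_one hp.ne']; congr 1; ring
    have hG0 := (Real.Gamma_pos_of_pos hp).ne'
    have := hp.ne'
    unfold bT
    rw [hG]
    field_simp
  have e2 : ∀ m : ℕ, (x / 2) ^ 2 * bT (ν + 2) x m = - (((m + 1 : ℕ) : ℝ) * bT (ν + 1) x (m + 1)) := by
    intro m
    unfold bT
    have hp : 0 < (m : ℝ) + ν + 3 := by have : (0:ℝ) ≤ m := Nat.cast_nonneg m; linarith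
    have hG0 := (Real.Gamma_pos_of_pos hp).ne'
    have a1 : (m : ℝ) + (ν + 2) + 1 = m + ν + 3 := by ring
    have a2 : ((m + 1 : ℕ) : ℝ) + (ν + 1) + 1 = m + ν + 3 := by push_cast; ring
    rw [a1, a2, Nat.factorial_succ]
    push_cast
    field_simp
    ring
  have sm : Summable (fun m : ℕ => (m : ℝ) * bT (ν + 1) x m) := by
    have : (fun m : ℕ => (m : ℝ) * bT (ν + 1) x m) = fun m => bT ν x m - (ν + 1) * bT (ν + 1) x m := by
      ext m; rw [e0]; ring
    rw [this]
    exact s0.sub (s1.mul_left _)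
  have t0 : ∑' m, bT ν x m = (∑' m : ℕ, (m : ℝ) * bT (ν + 1) x m) + (ν + 1) * ∑' m, bT (ν + 1) x m := by
    rw [← tsum_mul_left, ← sm.tsum_add (s1.mul_left _)]
    exact tsum_congr fun m => by rw [e0]; ring
  have t2 : (x / 2) ^ 2 * (∑' m, bT (ν + 2) x m) = - ∑' m : ℕ, (m : ℝ) * bT (ν + 1) x m := by
    rw [← tsum_mul_left, sm.tsum_eq_zero_add, tsum_congr e2, tsum_neg]
    simp
  rw [t0, t2]; ring

lemma besselJ_rec (ν x : ℝ) (hν : -1 < ν) (hx : 0 < x) :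
    besselJ ν x = 2 * (ν + 1) / x * besselJ (ν + 1) x - besselJ (ν + 2) x := by
  have h := bT_rec ν x hν
  have hx2 : 0 < x / 2 := by positivity
  rw [besselJ_eq_s10, besselJ_eq_s10, besselJ_eq_s10, Real.rpow_add hx2, Real.rpow_add hx2, Real.rpow_one,
    show (x/2) ^ (2:ℝ) = (x/2)^2 by norm_cast]
  have : 2 * (ν + 1) / x * ((∑' m, bT (ν + 1) x m) * ((x / 2) ^ ν * (x / 2)))
    = ((ν + 1) * ∑' m, bT (ν + 1) x m) * (x/2)^ν := by field_simp
  rw [this, ← h]; ring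

lemma besselJ_small (ν : ℝ) (hν : -(1 / 2 : ℝ) ≤ ν) :
    ∃ C : ℝ, 0 ≤ C ∧ ∀ z : ℝ, 0 < z → z ≤ 1 → |besselJ ν z| ≤ C * z ^ (-(1:ℝ)/2) := by
  have s1 := (bT_summable ν 1 (by linarith)).norm
  refine ⟨(∑' m, ‖bT ν 1 m‖) * (1/2) ^ ν, mul_nonneg (tsum_nonneg fun _ => norm_nonneg _) (by positivity), ?_⟩
  intro z hz hz1
  rw [besselJ_eq_s10, abs_mul, abs_of_nonneg (a := (z/2)^ν) (by positivity), show z / 2 = 1/2 * z by ring,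
    Real.mul_rpow (by norm_num) hz.le, ← mul_assoc]
  refine mul_le_mul ?_ (Real.rpow_le_rpow_of_exponent_ge hz hz1 (by linarith)) (by positivity)
    (mul_nonneg (tsum_nonneg fun _ => norm_nonneg _) (by positivity))
  refine mul_le_mul_of_nonneg_right ?_ (by positivity)
  have s2 := (bT_summable ν z (by linarith)).norm
  rw [← Real.norm_eq_abs]
  refine (norm_tsum_le_tsum_norm s2).trans (s2.tsum_le_tsum (fun m => ?_) s1)
  unfold bT
  rw [norm_mul, norm_mul]
  refine mul_le_mul_of_nonneg_left ?_ (norm_nonneg _)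
  rw [norm_pow, norm_pow]
  refine pow_le_pow_left₀ (norm_nonneg _) ?_ _
  rw [Real.norm_eq_abs, Real.norm_eq_abs, abs_of_pos (by positivity), abs_of_pos (by positivity)]
  linarith

noncomputable def momI (μ : ℝ) (m : ℕ) : ℝ := ∫ x in (0:ℝ)..1, x ^ (2 * m) * (1 - x ^ 2) ^ μ

lemma cont_w (μ : ℝ) (hμ : 0 ≤ μ) : Continuous (fun x : ℝ => (1 - x ^ 2) ^ μ) :=
  (continuous_const.sub (continuous_pow 2)).rpow_const fun _ => Or.inr hμ

lemma momI_zero (μ : ℝ) (hμ : 1 ≤ μ) :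
    momI μ 0 = √Real.pi * Real.Gamma (μ + 1) / (2 * Real.Gamma (μ + 3 / 2)) := by
  have hc := cont_w μ (by linarith)
  have h1 : ∫ x in (-1:ℝ)..1, (1 - x ^ 2) ^ μ = 2 * momI μ 0 := by
    rw [← intervalIntegral.integral_add_adjacent_intervals (b := 0)
      (hc.intervalIntegrable _ _) (hc.intervalIntegrable _ _)]
    have := intervalIntegral.integral_comp_neg (a := 0) (b := 1) (fun x : ℝ => (1 - x ^ 2) ^ μ)
    simp only [neg_sq, neg_zero] at this
    rw [← this]
    simp [momI]; ring
  have h2 := intervalIntegral.integral_comp_mul_sub (a := 0) (b := 1)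
    (fun x : ℝ => (1 - x ^ 2) ^ μ) (two_ne_zero) 1
  have h3 : ∫ x in (0:ℝ)..1, (1 - (2 * x - 1) ^ 2) ^ μ = 4 ^ μ * ∫ x in (0:ℝ)..1, x ^ μ * (1 - x) ^ μ := by
    rw [← intervalIntegral.integral_const_mul]
    refine intervalIntegral.integral_congr fun x hx => ?_
    rw [Set.uIcc_of_le zero_le_one] at hx
    have : 1 - (2 * x - 1) ^ 2 = 4 * (x * (1 - x)) := by ring
    simp only [this]
    rw [Real.mul_rpow (by norm_num) (mul_nonneg hx.1 (by linarith [hx.2])),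
      Real.mul_rpow hx.1 (by linarith [hx.2])]
  have h4 : ∫ x in (0:ℝ)..1, x ^ μ * (1 - x) ^ μ
      = Real.Gamma (μ + 1) * Real.Gamma (μ + 1) / Real.Gamma (2 * μ + 2) := by
    have := ProbabilityTheory.beta_eq_betaIntegralReal (μ + 1) (μ + 1) (by linarith) (by linarith)
    rw [ProbabilityTheory.beta, show μ + 1 + (μ + 1) = 2 * μ + 2 by ring] at this
    rw [this, Complex.betaIntegral, ← Complex.ofReal_re (∫ x in (0:ℝ)..1, x ^ μ * (1 - x) ^ μ),
      ← intervalIntegral.integral_ofReal]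
    congr 1
    refine intervalIntegral.integral_congr fun x hx => ?_
    rw [Set.uIcc_of_le zero_le_one] at hx
    rw [Complex.ofReal_mul, Complex.ofReal_cpow hx.1, Complex.ofReal_cpow (by linarith [hx.2])]
    push_cast
    simp
  have h5 := Real.Gamma_mul_Gamma_add_half (μ + 1)
  rw [show 2 * (μ + 1) = 2 * μ + 2 by ring, show μ + 1 + 1 / 2 = μ + 3 / 2 by ring,
    show 1 - (2 * μ + 2) = -(1 + 2 * μ) by ring, Real.rpow_neg (by norm_num), Real.rpow_add (by norm_num),
    Real.rpow_mul (by norm_num), Real.rpow_one, show (2:ℝ) ^ (2:ℝ) = 4 by norm_num] at h5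
  rw [h3, h4] at h2
  norm_num at h2
  rw [h1] at h2
  have g1 := (Real.Gamma_pos_of_pos (show 0 < μ + 1 by linarith))
  have g2 := (Real.Gamma_pos_of_pos (show 0 < μ + 3 / 2 by linarith))
  have g3 := (Real.Gamma_pos_of_pos (show 0 < 2 * μ + 2 by linarith))
  have g4 : (0:ℝ) < 4 ^ μ := by positivity
  have h6 : momI μ 0 = 4 ^ μ * (Real.Gamma (μ + 1) * Real.Gamma (μ + 1) / Real.Gamma (2 * μ + 2)) := by
    linarith
  rw [h6]
  field_simp at h5 ⊢
  linear_combination h5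

lemma momI_succ (μ : ℝ) (hμ : 1 ≤ μ) (m : ℕ) :
    momI μ (m + 1) = (2 * m + 1) / (2 * (m + μ + 3 / 2)) * momI μ m := by
  have hc := cont_w μ (by linarith)
  have hd : ∀ x : ℝ, HasDerivAt (fun x : ℝ => x ^ (2 * m + 1) * (1 - x ^ 2) ^ (μ + 1))
      ((2 * m + 1) * x ^ (2 * m) * (1 - x ^ 2) ^ (μ + 1)
        - 2 * (μ + 1) * x ^ (2 * (m + 1)) * (1 - x ^ 2) ^ μ) x := by
    intro x
    have h1 := hasDerivAt_pow (2 * m + 1) x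
    have h2 := ((hasDerivAt_pow 2 x).const_sub 1).rpow_const (p := μ + 1) (Or.inr (by linarith))
    convert! h1.mul h2 using 1
    simp
    ring
  have hc1 := cont_w (μ + 1) (by linarith)
  have hi := intervalIntegral.integral_eq_sub_of_hasDerivAt (a := 0) (b := 1) (fun x _ => hd x)
    (by apply Continuous.intervalIntegrable; fun_prop)
  have h0 : (0:ℝ) ^ (μ + 1) = 0 := Real.zero_rpow (by linarith)
  simp [h0] at hi
  have he : ∫ x in (0:ℝ)..1, ((2 * m + 1) * x ^ (2 * m) * (1 - x ^ 2) ^ (μ + 1)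
        - 2 * (μ + 1) * x ^ (2 * (m + 1)) * (1 - x ^ 2) ^ μ) =
      (2 * m + 1) * momI μ m - (2 * (m + μ + 3 / 2)) * momI μ (m + 1) := by
    unfold momI
    rw [← intervalIntegral.integral_const_mul, ← intervalIntegral.integral_const_mul,
      ← intervalIntegral.integral_sub (by apply Continuous.intervalIntegrable; fun_prop)
        (by apply Continuous.intervalIntegrable; fun_prop)]
    refine intervalIntegral.integral_congr fun x hx => ?_
    rw [Set.uIcc_of_le zero_le_one] at hx
    have h2 : 0 ≤ 1 - x ^ 2 := by nlinarith [hx.1, hx.2]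
    rw [Real.rpow_add_one' h2 (by linarith)]
    ring
  rw [hi] at he
  have : (0:ℝ) < m + μ + 3 / 2 := by positivity
  field_simp
  linarith

lemma momI_eq (μ : ℝ) (hμ : 1 ≤ μ) (m : ℕ) :
    momI μ m = (Nat.factorial (2 * m)) / (4 ^ m * Nat.factorial m) *
      (√Real.pi * Real.Gamma (μ + 1) / (2 * Real.Gamma (m + μ + 3 / 2))) := by
  induction m with
  | zero => rw [momI_zero μ hμ]; simp
  | succ m ih =>
    have hp : (0:ℝ) < m + μ + 3 / 2 := by positivity
    rw [momI_succ μ hμ, ih, show 2 * (m + 1) = 2 * m + 1 + 1 by ring, Nat.factorial_succ,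
      Nat.factorial_succ, Nat.factorial_succ]
    have hG : Real.Gamma (((m + 1 : ℕ) : ℝ) + μ + 3 / 2)
        = (m + μ + 3 / 2) * Real.Gamma (m + μ + 3 / 2) := by
      rw [← Real.Gamma_add_one hp.ne']; congr 1; push_cast; ring
    rw [hG]
    have hG0 := (Real.Gamma_pos_of_pos hp).ne'
    push_cast
    field_simp
    ring

lemma poisson (μ z : ℝ) (hμ : 1 ≤ μ) (hz : 0 < z) :
    ∫ x in (0:ℝ)..1, Real.cos (z * x) * (1 - x ^ 2) ^ μ =
      √Real.pi * Real.Gamma (μ + 1) / 2 * ∑' m, bT (μ + 1 / 2) z m := by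
  have hc := cont_w μ (by linarith)
  have hs := intervalIntegral.hasSum_integral_of_dominated_convergence (a := 0) (b := 1)
    (μ := MeasureTheory.volume)
    (F := fun (m : ℕ) (x : ℝ) => ((-1) ^ m * (z * x) ^ (2 * m) / Nat.factorial (2 * m)) * (1 - x ^ 2) ^ μ)
    (f := fun x => Real.cos (z * x) * (1 - x ^ 2) ^ μ)
    (fun m _ => z ^ (2 * m) / Nat.factorial (2 * m))
    (fun m => by apply Continuous.aestronglyMeasurable; fun_prop)
    (by
      intro m
      refine Filter.Eventually.of_forall fun x hx => ?_
      rw [Set.uIoc_of_le zero_le_one] at hx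
      have h2 : 0 ≤ 1 - x ^ 2 := by nlinarith [hx.1, hx.2]
      have h3 : (1 - x ^ 2) ^ μ ≤ 1 := Real.rpow_le_one h2 (by nlinarith) (by linarith)
      have h4 : x ^ (2 * m) ≤ 1 := pow_le_one₀ hx.1.le hx.2
      have h5 : 0 ≤ x ^ (2 * m) := pow_nonneg hx.1.le _
      rw [norm_mul, norm_div, norm_mul, norm_pow, norm_neg, norm_one, one_pow, one_mul,
        Real.norm_of_nonneg (Real.rpow_nonneg h2 _), mul_pow, norm_mul, Real.norm_of_nonneg h5,
        Real.norm_of_nonneg (pow_nonneg hz.le _), Real.norm_natCast]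
      refine (mul_le_of_le_one_right (by positivity) h3).trans ?_
      gcongr
      exact mul_le_of_le_one_right (by positivity) h4)
    (Filter.Eventually.of_forall fun x _ => (Real.hasSum_cosh z).summable)
    (by simp)
    (Filter.Eventually.of_forall fun x _ => (Real.hasSum_cos (z * x)).mul_right _)
  rw [← hs.tsum_eq, ← tsum_mul_left]
  refine tsum_congr fun m => ?_
  have : ∫ x in (0:ℝ)..1, ((-1) ^ m * (z * x) ^ (2 * m) / Nat.factorial (2 * m)) * (1 - x ^ 2) ^ μ
      = ((-1) ^ m * z ^ (2 * m) / Nat.factorial (2 * m)) * momI μ m := by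
    unfold momI
    rw [← intervalIntegral.integral_const_mul]
    congr 1; ext x; rw [mul_pow]; ring
  rw [this, momI_eq μ hμ]
  unfold bT
  have hp : (0:ℝ) < m + μ + 3 / 2 := by positivity
  have hG0 := (Real.Gamma_pos_of_pos hp).ne'
  rw [show (m:ℝ) + (μ + 1 / 2) + 1 = m + μ + 3 / 2 by ring, div_pow, pow_mul 2 2 m]
  norm_num
  field_simp

open MeasureTheory Set Filter Topology in
lemma exp_int (a z : ℝ) (ha : 0 ≤ a) (hz : 0 < z) :
    IntegrableOn (fun y : ℝ => y ^ a * Real.exp (-(z * y))) (Ioi 0) := by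
  have := integrableOn_rpow_mul_exp_neg_mul_rpow (p := 1) (s := a) (b := z) (by linarith) (by norm_num) hz
  simpa using this

lemma exp_int_eq (a z : ℝ) (ha : 0 ≤ a) (hz : 0 < z) :
    ∫ y in Set.Ioi (0:ℝ), y ^ a * Real.exp (-(z * y)) = (1 / z) ^ (a + 1) * Real.Gamma (a + 1) := by
  have := Real.integral_rpow_mul_exp_neg_mul_Ioi (a := a + 1) (r := z) (by linarith) hz
  simpa using this

noncomputable def cD (μ : ℝ) (y : ℝ) : ℂ :=
  ((y : ℂ) - 2 * Complex.I) ^ (μ : ℂ) - (-2 * Complex.I) ^ (μ : ℂ)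

lemma slit_mem (y : ℝ) : (y : ℂ) - 2 * Complex.I ∈ Complex.slitPlane := by
  right; simp

lemma cD_hasDeriv (μ : ℝ) (y : ℝ) :
    HasDerivAt (cD μ) ((μ : ℂ) * ((y : ℂ) - 2 * Complex.I) ^ ((μ : ℂ) - 1)) y := by
  have h1 : HasDerivAt (fun w : ℂ => w - 2 * Complex.I) 1 (y : ℂ) :=
    (hasDerivAt_id _).sub_const _
  have h2 := ((h1.cpow_const (c := (μ:ℂ)) (slit_mem y)).sub_const
    ((-2 * Complex.I) ^ (μ : ℂ))).comp_ofReal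
  rw [mul_one] at h2
  exact h2

lemma add_two_rpow (y p : ℝ) (hy : 0 ≤ y) (hp : 0 ≤ p) : (y + 2) ^ p ≤ 2 ^ p * y ^ p + 4 ^ p := by
  rcases le_total y 2 with h | h
  · have : (y + 2) ^ p ≤ 4 ^ p := Real.rpow_le_rpow (by linarith) (by linarith) hp
    have : 0 ≤ 2 ^ p * y ^ p := by positivity
    linarith
  · rw [← Real.mul_rpow (by norm_num) hy]
    have : (y + 2) ^ p ≤ (2 * y) ^ p := Real.rpow_le_rpow (by linarith) (by linarith) hp
    have : (0:ℝ) ≤ 4 ^ p := by positivity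
    linarith

lemma cD_bound (μ : ℝ) (hμ : 1 ≤ μ) (y : ℝ) (hy : 0 ≤ y) :
    ‖cD μ y‖ ≤ μ * (2 ^ (μ - 1) * y ^ (μ - 1) + 4 ^ (μ - 1)) * y := by
  have h := norm_image_sub_le_of_norm_deriv_le_segment' (f := cD μ) (a := 0) (b := y)
    (C := μ * (2 ^ (μ - 1) * y ^ (μ - 1) + 4 ^ (μ - 1)))
    (fun x _ => (cD_hasDeriv μ x).hasDerivWithinAt)
    (by
      intro x hx
      rw [norm_mul, Complex.norm_real, Real.norm_of_nonneg (by linarith),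
        show (μ : ℂ) - 1 = ((μ - 1 : ℝ) : ℂ) by push_cast; rfl, Complex.norm_cpow_real]
      refine mul_le_mul_of_nonneg_left ?_ (by linarith)
      refine le_trans ?_ (add_two_rpow y (μ - 1) hy (by linarith))
      refine Real.rpow_le_rpow (norm_nonneg _) ?_ (by linarith)
      refine (norm_sub_le _ _).trans ?_
      simp [abs_of_nonneg hx.1, hx.2.le])
    y ⟨hy, le_rfl⟩
  simpa [cD] using h

noncomputable def wt (μ z y : ℝ) : ℝ := y ^ μ * Real.exp (-(z * y))

lemma D_norm (μ : ℝ) (hμ : 1 ≤ μ) (z y : ℝ) (hy : 0 < y) :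
    ‖((wt μ z y : ℝ) : ℂ) * cD μ y‖ ≤
      μ * 2 ^ (μ - 1) * (y ^ (2 * μ) * Real.exp (-(z * y))) +
      μ * 4 ^ (μ - 1) * (y ^ (μ + 1) * Real.exp (-(z * y))) := by
  have hw : 0 ≤ wt μ z y := by unfold wt; positivity
  rw [norm_mul, Complex.norm_real, Real.norm_of_nonneg hw]
  refine (mul_le_mul_of_nonneg_left (cD_bound μ hμ y hy.le) hw).trans (le_of_eq ?_)
  unfold wt
  rw [show 2 * μ = μ + (μ - 1) + 1 by ring, Real.rpow_add_one hy.ne', Real.rpow_add_one hy.ne',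
    Real.rpow_add hy]
  ring

open MeasureTheory Set in
lemma D_bound_int (μ z : ℝ) (hμ : 1 ≤ μ) (hz : 0 < z) :
    IntegrableOn (fun y : ℝ => μ * 2 ^ (μ - 1) * (y ^ (2 * μ) * Real.exp (-(z * y))) +
      μ * 4 ^ (μ - 1) * (y ^ (μ + 1) * Real.exp (-(z * y)))) (Ioi 0) :=
  ((exp_int (2 * μ) z (by linarith) hz).const_mul _).add
    ((exp_int (μ + 1) z (by linarith) hz).const_mul _)

lemma wt_cont (μ z : ℝ) (hμ : 1 ≤ μ) : Continuous (wt μ z) := by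
  unfold wt
  exact (continuous_id.rpow_const fun _ => Or.inr (by linarith)).mul (by fun_prop)

lemma cD_cont (μ : ℝ) : Continuous (cD μ) :=
  continuous_iff_continuousAt.2 fun y => (cD_hasDeriv μ y).continuousAt

open MeasureTheory Set in
lemma D_int (μ z : ℝ) (hμ : 1 ≤ μ) (hz : 0 < z) :
    IntegrableOn (fun y : ℝ => ((wt μ z y : ℝ) : ℂ) * cD μ y) (Ioi 0) := by
  refine Integrable.mono' (D_bound_int μ z hμ hz) ?_ ?_
  · apply Continuous.aestronglyMeasurable
    exact (Complex.continuous_ofReal.comp (wt_cont μ z hμ)).mul (cD_cont μ)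
  · exact (ae_restrict_mem measurableSet_Ioi).mono fun y hy => D_norm μ hμ z y hy

open MeasureTheory Set in
lemma D_est (μ : ℝ) (hμ : 1 ≤ μ) : ∃ K : ℝ, 0 ≤ K ∧ ∀ z : ℝ, 1 ≤ z →
    ‖∫ y in Ioi (0:ℝ), ((wt μ z y : ℝ) : ℂ) * cD μ y‖ ≤ K * z ^ (-(μ + 2)) := by
  have g1 := (Real.Gamma_pos_of_pos (show 0 < 2 * μ + 1 by linarith))
  have g2 := (Real.Gamma_pos_of_pos (show 0 < μ + 1 + 1 by linarith))
  refine ⟨μ * 2 ^ (μ - 1) * Real.Gamma (2 * μ + 1) + μ * 4 ^ (μ - 1) * Real.Gamma (μ + 1 + 1),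
    by positivity, fun z hz => ?_⟩
  have hz0 : 0 < z := by linarith
  refine (norm_integral_le_of_norm_le (D_bound_int μ z hμ hz0)
    ((ae_restrict_mem measurableSet_Ioi).mono fun y hy => D_norm μ hμ z y hy)).trans ?_
  rw [integral_add ((exp_int (2 * μ) z (by linarith) hz0).const_mul _)
    ((exp_int (μ + 1) z (by linarith) hz0).const_mul _), integral_const_mul, integral_const_mul,
    exp_int_eq _ _ (by linarith) hz0, exp_int_eq _ _ (by linarith) hz0]
  have e1 : (1 / z) ^ (2 * μ + 1) ≤ z ^ (-(μ + 2)) := by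
    rw [one_div, Real.inv_rpow hz0.le, ← Real.rpow_neg hz0.le]
    exact Real.rpow_le_rpow_of_exponent_le hz (by linarith)
  have e2 : (1 / z) ^ (μ + 1 + 1) = z ^ (-(μ + 2)) := by
    rw [one_div, Real.inv_rpow hz0.le, ← Real.rpow_neg hz0.le]; congr 1; ring
  rw [e2]
  have := mul_le_mul_of_nonneg_left e1 (show 0 ≤ μ * 2 ^ (μ - 1) * Real.Gamma (2 * μ + 1) by positivity)
  linarith

noncomputable def cF (μ z : ℝ) (w : ℂ) : ℂ := Complex.exp (Complex.I * z * w) * (1 - w ^ 2) ^ (μ : ℂ)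

lemma cF_side (μ z y : ℝ) (hy : 0 < y) :
    cF μ z (1 + y * Complex.I) = Complex.exp (Complex.I * z) *
      (((wt μ z y : ℝ) : ℂ) * cD μ y + ((wt μ z y : ℝ) : ℂ) * (-2 * Complex.I) ^ (μ : ℂ)) := by
  have h1 : (1 : ℂ) - (1 + y * Complex.I) ^ 2 = y * (y - 2 * Complex.I) := by
    linear_combination (-(y:ℂ)^2) * Complex.I_sq
  have hne := Complex.slitPlane_ne_zero (slit_mem y)
  have hy' : (y : ℂ) ≠ 0 := by exact_mod_cast hy.ne'
  have h2 : ((y : ℂ) * (y - 2 * Complex.I)) ^ (μ : ℂ) = (y : ℂ) ^ (μ : ℂ) * (y - 2 * Complex.I) ^ (μ : ℂ) := by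
    rw [Complex.cpow_def_of_ne_zero (mul_ne_zero hy' hne), Complex.log_ofReal_mul hy hne,
      Complex.cpow_def_of_ne_zero hy', Complex.cpow_def_of_ne_zero hne, ← Complex.exp_add,
      Complex.ofReal_log hy.le]
    ring_nf
  have h3 : Complex.exp (Complex.I * z * (1 + y * Complex.I)) =
      Complex.exp (Complex.I * z) * ((Real.exp (-(z * y)) : ℝ) : ℂ) := by
    rw [Complex.ofReal_exp, ← Complex.exp_add]
    congr 1
    push_cast
    linear_combination (z * y : ℂ) * Complex.I_sq
  unfold cF cD wt
  rw [h1, h2, h3, Complex.ofReal_mul, Complex.ofReal_cpow hy.le]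
  ring

lemma cF_contAt (μ z : ℝ) (hμ : 1 ≤ μ) (w : ℂ) (h1 : |w.re| ≤ 1) :
    ContinuousAt (cF μ z) w := by
  unfold cF
  refine ContinuousAt.mul (by fun_prop) ?_
  have : ContinuousAt (fun w : ℂ => w ^ (μ : ℂ)) (1 - w ^ 2) := by
    refine Complex.continuousAt_cpow_const_of_re_pos ?_ (by simpa using by linarith)
    left
    have := (sq_le_one_iff_abs_le_one w.re).2 h1
    simp [pow_two] at this ⊢
    nlinarith [mul_self_nonneg w.im]
  exact ContinuousAt.comp (g := fun w : ℂ => w ^ (μ : ℂ)) (f := fun w : ℂ => 1 - w ^ 2) this (by fun_prop)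

lemma cF_diffAt (μ z : ℝ) (w : ℂ) (h1 : |w.re| < 1) :
    DifferentiableAt ℂ (cF μ z) w := by
  unfold cF
  refine DifferentiableAt.mul (by fun_prop) ?_
  refine DifferentiableAt.cpow_const (by fun_prop) ?_
  left
  have := (sq_lt_one_iff_abs_lt_one w.re).2 h1
  simp [pow_two] at this ⊢
  nlinarith [mul_self_nonneg w.im]

lemma cF_real (μ z x : ℝ) (h0 : 0 ≤ x) (h1 : x ≤ 1) :
    (cF μ z x).re = Real.cos (z * x) * (1 - x ^ 2) ^ μ := by
  have h2 : 0 ≤ 1 - x ^ 2 := by nlinarith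
  have : cF μ z x = Complex.exp ((z * x : ℝ) * Complex.I) * (((1 - x ^ 2) ^ μ : ℝ) : ℂ) := by
    unfold cF
    rw [Complex.ofReal_cpow h2]
    push_cast
    congr 2
    ring
  rw [this, Complex.re_mul_ofReal, Complex.exp_ofReal_mul_I_re]

lemma cF_imag (μ z y : ℝ) :
    (Complex.I * cF μ z (y * Complex.I)).re = 0 := by
  have h2 : 0 ≤ 1 + y ^ 2 := by positivity
  have : cF μ z (y * Complex.I) = ((Real.exp (-(z * y)) * (1 + y ^ 2) ^ μ : ℝ) : ℂ) := by
    unfold cF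
    rw [Complex.ofReal_mul, Complex.ofReal_cpow h2, Complex.ofReal_exp]
    congr 2
    · push_cast; linear_combination (z * y : ℂ) * Complex.I_sq
    · push_cast; linear_combination (-(y:ℂ)^2) * Complex.I_sq
  rw [this, Complex.re_mul_ofReal]
  simp

lemma cF_top (μ z x R : ℝ) (hμ : 1 ≤ μ) (h0 : 0 ≤ x) (h1 : x ≤ 1) (hR : 1 ≤ R) :
    ‖cF μ z (x + R * Complex.I)‖ ≤ 5 ^ μ * (R ^ (2 * μ) * Real.exp (-(z * R))) := by
  unfold cF
  rw [norm_mul, Complex.norm_exp, Complex.norm_cpow_real]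
  have e1 : (Complex.I * z * (x + R * Complex.I)).re = -(z * R) := by simp
  rw [e1]
  have e2 : ‖(1:ℂ) - (x + R * Complex.I) ^ 2‖ ≤ 5 * R ^ 2 := by
    refine (norm_sub_le _ _).trans ?_
    rw [norm_pow, norm_one]
    have : ‖(x:ℂ) + R * Complex.I‖ ≤ 2 * R := by
      refine (norm_add_le _ _).trans ?_
      simp [abs_of_nonneg h0, abs_of_nonneg (zero_le_one.trans hR)]
      linarith
    nlinarith [norm_nonneg ((x:ℂ) + R * Complex.I)]
  have e3 : ‖(1:ℂ) - (x + R * Complex.I) ^ 2‖ ^ μ ≤ 5 ^ μ * R ^ (2 * μ) := by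
    refine (Real.rpow_le_rpow (norm_nonneg _) e2 (by linarith)).trans (le_of_eq ?_)
    rw [Real.mul_rpow (by norm_num) (by positivity), Real.rpow_mul (by linarith)]
    norm_cast
  calc _ ≤ Real.exp (-(z * R)) * (5 ^ μ * R ^ (2 * μ)) := by gcongr
    _ = _ := by ring

open MeasureTheory Set Filter Topology in
lemma contour (μ z : ℝ) (hμ : 1 ≤ μ) (hz : 0 < z) :
    ∫ x in (0:ℝ)..1, Real.cos (z * x) * (1 - x ^ 2) ^ μ =
      (-Complex.I * ∫ y in Ioi (0:ℝ), cF μ z (1 + y * Complex.I)).re := by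
  have hcont : ∀ w : ℂ, |w.re| ≤ 1 → ContinuousAt (cF μ z) w := cF_contAt μ z hμ
  -- real part of the base
  have hbase : (∫ x in (0:ℝ)..1, cF μ z x).re = ∫ x in (0:ℝ)..1, Real.cos (z * x) * (1 - x ^ 2) ^ μ := by
    have hi : IntervalIntegrable (fun x : ℝ => cF μ z x) volume 0 1 := by
      apply ContinuousOn.intervalIntegrable
      intro x hx
      rw [uIcc_of_le zero_le_one] at hx
      refine ContinuousAt.continuousWithinAt ?_
      exact ContinuousAt.comp (g := cF μ z) (f := fun x : ℝ => (x:ℂ))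
        (hcont _ (by simpa [abs_of_nonneg hx.1] using hx.2)) (by fun_prop)
    have := Complex.reCLM.intervalIntegral_comp_comm hi
    simp only [Complex.reCLM_apply] at this
    rw [← this]
    refine intervalIntegral.integral_congr fun x hx => ?_
    rw [uIcc_of_le zero_le_one] at hx
    exact cF_real μ z x hx.1 hx.2
  have himag : ∀ R : ℝ, (Complex.I * ∫ y in (0:ℝ)..R, cF μ z (y * Complex.I)).re = 0 := by
    intro R
    have hi : IntervalIntegrable (fun y : ℝ => Complex.I * cF μ z (y * Complex.I)) volume 0 R := by
      apply Continuous.intervalIntegrable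
      refine continuous_const.mul (continuous_iff_continuousAt.2 fun y => ?_)
      exact ContinuousAt.comp (g := cF μ z) (f := fun y : ℝ => (y:ℂ) * Complex.I)
        (hcont _ (by simp)) (by fun_prop)
    have := Complex.reCLM.intervalIntegral_comp_comm hi
    simp only [Complex.reCLM_apply] at this
    rw [← intervalIntegral.integral_const_mul, ← this]
    simp only [cF_imag]
    simp
  have hrect : ∀ R : ℝ, 1 ≤ R → (∫ x in (0:ℝ)..1, cF μ z x) = (∫ x in (0:ℝ)..1, cF μ z (x + R * Complex.I))
      - Complex.I * (∫ y in (0:ℝ)..R, cF μ z (1 + y * Complex.I))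
      + Complex.I * (∫ y in (0:ℝ)..R, cF μ z (y * Complex.I)) := by
    intro R hR
    have := Complex.integral_boundary_rect_eq_zero_of_continuousOn_of_differentiableOn (cF μ z) 0
      (1 + R * Complex.I)
      (by
        intro w hw
        rw [Complex.mem_reProdIm] at hw
        simp at hw
        exact (hcont w (by rw [abs_of_nonneg hw.1.1]; exact hw.1.2)).continuousWithinAt)
      (by
        intro w hw
        rw [Complex.mem_reProdIm] at hw
        simp at hw
        exact (cF_diffAt μ z w (by rw [abs_of_pos hw.1.1]; exact hw.1.2)).differentiableWithinAt)
    simp at this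
    linear_combination this
  have hint : IntegrableOn (fun y : ℝ => cF μ z (1 + y * Complex.I)) (Ioi 0) := by
    have h0 : IntegrableOn (fun y : ℝ => Complex.exp (Complex.I * z) *
      (((wt μ z y : ℝ) : ℂ) * cD μ y + ((wt μ z y : ℝ) : ℂ) * (-2 * Complex.I) ^ (μ : ℂ))) (Ioi 0) :=
      ((D_int μ z hμ hz).add (((exp_int μ z (by linarith) hz).ofReal).mul_const _)).const_mul _
    exact h0.congr_fun (fun y hy => (cF_side μ z y hy).symm) measurableSet_Ioi
  have hlim : Tendsto (fun R : ℝ => ∫ y in (0:ℝ)..R, cF μ z (1 + y * Complex.I)) atTop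
      (𝓝 (∫ y in Ioi (0:ℝ), cF μ z (1 + y * Complex.I))) :=
    intervalIntegral_tendsto_integral_Ioi 0 hint tendsto_id
  have htop : Tendsto (fun R : ℝ => ∫ x in (0:ℝ)..1, cF μ z (x + R * Complex.I)) atTop (𝓝 0) := by
    have h1 : Tendsto (fun R : ℝ => 5 ^ μ * (R ^ (2 * μ) * Real.exp (-(z * R)))) atTop (𝓝 0) := by
      have := (tendsto_rpow_mul_exp_neg_mul_atTop_nhds_zero (2 * μ) z hz).const_mul (5 ^ μ)
      simpa using this
    refine squeeze_zero_norm' ?_ h1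
    filter_upwards [eventually_ge_atTop 1] with R hR
    have := intervalIntegral.norm_integral_le_of_norm_le_const (a := 0) (b := 1)
      (f := fun x : ℝ => cF μ z (x + R * Complex.I))
      (C := 5 ^ μ * (R ^ (2 * μ) * Real.exp (-(z * R)))) (by
        intro x hx
        rw [uIoc_of_le zero_le_one] at hx
        exact cF_top μ z x R hμ hx.1.le hx.2 hR)
    simpa using this
  have hT : Tendsto (fun R : ℝ => ((∫ x in (0:ℝ)..1, cF μ z (x + R * Complex.I))
      + -Complex.I * (∫ y in (0:ℝ)..R, cF μ z (1 + y * Complex.I))).re) atTop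
      (𝓝 (0 + -Complex.I * ∫ y in Ioi (0:ℝ), cF μ z (1 + y * Complex.I)).re) :=
    (Complex.continuous_re.tendsto _).comp (htop.add (hlim.const_mul _))
  rw [zero_add] at hT
  refine tendsto_nhds_unique (tendsto_const_nhds.congr' ?_) hT
  filter_upwards [eventually_ge_atTop 1] with R hR
  rw [← hbase, hrect R hR, Complex.add_re _ (Complex.I * ∫ y in (0:ℝ)..R, cF μ z (y * Complex.I)),
    himag R, add_zero, sub_eq_add_neg, neg_mul]

lemma phase (μ z : ℝ) :
    (-Complex.I * (Complex.exp (Complex.I * z) * (-2 * Complex.I) ^ (μ : ℂ))).re =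
      2 ^ μ * Real.cos (z - (μ + 1) / 2 * Real.pi) := by
  have hne : (-2 * Complex.I : ℂ) ≠ 0 := by simp
  have hlog : Complex.log (-2 * Complex.I) = Real.log 2 - Real.pi / 2 * Complex.I := by
    rw [show (-2 * Complex.I : ℂ) = ((2:ℝ):ℂ) * (-Complex.I) by push_cast; ring,
      Complex.log_ofReal_mul (by norm_num) (by simp), Complex.log_neg_I]
    ring
  have hI : -Complex.I = Complex.exp (-(Real.pi / 2 * Complex.I)) := by
    rw [← neg_mul, ← neg_div, Complex.exp_neg_pi_div_two_mul_I]
  have : -Complex.I * (Complex.exp (Complex.I * z) * (-2 * Complex.I) ^ (μ : ℂ)) =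
      ((2 ^ μ : ℝ) : ℂ) * Complex.exp ((z - (μ + 1) / 2 * Real.pi : ℝ) * Complex.I) := by
    rw [Complex.cpow_def_of_ne_zero hne, hlog]
    nth_rewrite 1 [hI]
    rw [Real.rpow_def_of_pos (by norm_num), Complex.ofReal_exp, ← Complex.exp_add, ← Complex.exp_add,
      ← Complex.exp_add]
    congr 1
    push_cast
    ring
  rw [this, Complex.re_ofReal_mul, Complex.exp_ofReal_mul_I_re]

open MeasureTheory Set in
lemma side_est (μ : ℝ) (hμ : 1 ≤ μ) : ∃ K : ℝ, 0 ≤ K ∧ ∀ z : ℝ, 1 ≤ z →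
    |(∫ x in (0:ℝ)..1, Real.cos (z * x) * (1 - x ^ 2) ^ μ) -
      2 ^ μ * Real.Gamma (μ + 1) * z ^ (-(μ + 1)) * Real.cos (z - (μ + 1) / 2 * Real.pi)|
      ≤ K * z ^ (-(μ + 2)) := by
  obtain ⟨K, hK, h⟩ := D_est μ hμ
  refine ⟨K, hK, fun z hz => ?_⟩
  have hz0 : 0 < z := by linarith
  have hG : (1 / z) ^ (μ + 1) = z ^ (-(μ + 1)) := by
    rw [one_div, Real.inv_rpow hz0.le, ← Real.rpow_neg hz0.le]
  have hw : ∫ y in Ioi (0:ℝ), ((wt μ z y : ℝ) : ℂ) = ((z ^ (-(μ + 1)) * Real.Gamma (μ + 1) : ℝ) : ℂ) := by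
    rw [integral_complex_ofReal, ← hG, ← exp_int_eq μ z (by linarith) hz0]; rfl
  have hwi : IntegrableOn (fun y : ℝ => ((wt μ z y : ℝ) : ℂ) * (-2 * Complex.I) ^ (μ : ℂ)) (Ioi 0) :=
    ((exp_int μ z (by linarith) hz0).ofReal).mul_const _
  rw [contour μ z hμ hz0, setIntegral_congr_fun measurableSet_Ioi (fun y hy => cF_side μ z y hy),
    integral_const_mul, integral_add (D_int μ z hμ hz0)
      hwi, integral_mul_const, hw]
  set D := ∫ y in Ioi (0:ℝ), ((wt μ z y : ℝ) : ℂ) * cD μ y with hD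
  have hre : (-Complex.I * (Complex.exp (Complex.I * z) * (D +
      ((z ^ (-(μ + 1)) * Real.Gamma (μ + 1) : ℝ) : ℂ) * (-2 * Complex.I) ^ (μ : ℂ)))).re =
      (-Complex.I * Complex.exp (Complex.I * z) * D).re +
      (z ^ (-(μ + 1)) * Real.Gamma (μ + 1)) * (2 ^ μ * Real.cos (z - (μ + 1) / 2 * Real.pi)) := by
    rw [← phase, ← Complex.re_ofReal_mul, ← Complex.add_re]
    congr 1
    ring
  rw [hre]
  have : (-Complex.I * Complex.exp (Complex.I * z) * D).re +
      (z ^ (-(μ + 1)) * Real.Gamma (μ + 1)) * (2 ^ μ * Real.cos (z - (μ + 1) / 2 * Real.pi))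
      - 2 ^ μ * Real.Gamma (μ + 1) * z ^ (-(μ + 1)) * Real.cos (z - (μ + 1) / 2 * Real.pi)
      = (-Complex.I * Complex.exp (Complex.I * z) * D).re := by ring
  rw [this]
  refine (Complex.abs_re_le_norm _).trans ?_
  rw [norm_mul, norm_mul, norm_neg, Complex.norm_I, Complex.norm_exp]
  simpa using h z hz

def BesselP (ν : ℝ) : Prop := ∃ C : ℝ, 0 ≤ C ∧ ∀ z : ℝ, 1 ≤ z →
  |besselJ ν z - √(2 / (Real.pi * z)) * Real.cos (z - (ν / 2 + 1 / 4) * Real.pi)| ≤ C * z ^ (-(3 / 2) : ℝ)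

lemma sqrt_eq (z : ℝ) (hz : 0 < z) : √(2 / (Real.pi * z)) = √2 / √Real.pi * z ^ (-(1 / 2) : ℝ) := by
  rw [Real.sqrt_div (by norm_num), Real.sqrt_mul Real.pi_pos.le, Real.rpow_neg hz.le,
    ← Real.sqrt_eq_rpow]
  field_simp

lemma besselP_large (ν : ℝ) (hν : 3 / 2 ≤ ν) : BesselP ν := by
  obtain ⟨μ, rfl⟩ : ∃ μ, ν = μ + 1 / 2 := ⟨ν - 1 / 2, by ring⟩
  have hμ : 1 ≤ μ := by linarith
  obtain ⟨K, hK, h⟩ := side_est μ hμ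
  have hG := Real.Gamma_pos_of_pos (show 0 < μ + 1 by linarith)
  have hpi : 0 < √Real.pi := Real.sqrt_pos.2 Real.pi_pos
  refine ⟨2 * (1 / 2) ^ (μ + 1 / 2) / (√Real.pi * Real.Gamma (μ + 1)) * K, by positivity, fun z hz => ?_⟩
  have hz0 : 0 < z := by linarith
  have h1 := h z hz
  set A := ∫ x in (0:ℝ)..1, Real.cos (z * x) * (1 - x ^ 2) ^ μ with hA
  have hP : A = √Real.pi * Real.Gamma (μ + 1) / 2 * ∑' m, bT (μ + 1 / 2) z m := poisson μ z hμ hz0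
  set Q := 2 * (1 / 2) ^ (μ + 1 / 2) / (√Real.pi * Real.Gamma (μ + 1)) with hQ
  have hQ0 : 0 ≤ Q := by positivity
  have hJ : besselJ (μ + 1 / 2) z = Q * z ^ (μ + 1 / 2) * A := by
    rw [besselJ_eq_s10, hP, show z / 2 = 1 / 2 * z by ring, Real.mul_rpow (by norm_num) hz0.le, hQ]
    field_simp
  have hc : √(2 / (Real.pi * z)) * Real.cos (z - ((μ + 1 / 2) / 2 + 1 / 4) * Real.pi) =
      Q * z ^ (μ + 1 / 2) * (2 ^ μ * Real.Gamma (μ + 1) * z ^ (-(μ + 1)) *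
        Real.cos (z - (μ + 1) / 2 * Real.pi)) := by
    rw [sqrt_eq z hz0, show (μ + 1 / 2) / 2 + 1 / 4 = (μ + 1) / 2 by ring]
    have e1 : z ^ (-(1 / 2) : ℝ) = z ^ (μ + 1 / 2) * z ^ (-(μ + 1)) := by
      rw [← Real.rpow_add hz0]; congr 1; ring
    have e2 : 2 * (1 / 2 : ℝ) ^ (μ + 1 / 2) * 2 ^ μ = √2 := by
      rw [one_div, Real.inv_rpow (by norm_num), ← Real.rpow_neg (by norm_num), Real.sqrt_eq_rpow]
      nth_rewrite 1 [← Real.rpow_one 2]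
      rw [← Real.rpow_add (by norm_num), ← Real.rpow_add (by norm_num)]
      congr 1; ring
    rw [e1, ← e2, hQ]
    field_simp
  rw [hJ, hc, ← mul_sub, abs_mul, abs_of_nonneg (by positivity)]
  refine (mul_le_mul_of_nonneg_left h1 (by positivity)).trans (le_of_eq ?_)
  have e3 : z ^ (-(3 / 2) : ℝ) = z ^ (μ + 1 / 2) * z ^ (-(μ + 2)) := by
    rw [← Real.rpow_add hz0]; congr 1; ring
  rw [e3]; ring

lemma besselP_down (ν : ℝ) (hν : -1 < ν) (h1 : BesselP (ν + 1)) (h2 : BesselP (ν + 2)) : BesselP ν := by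
  obtain ⟨C1, hC1, h1⟩ := h1
  obtain ⟨C2, hC2, h2⟩ := h2
  have hpi : 0 < √Real.pi := Real.sqrt_pos.2 Real.pi_pos
  refine ⟨2 * (ν + 1) * (√2 / √Real.pi + C1) + C2, by
    have : 0 ≤ ν + 1 := by linarith
    positivity, fun z hz => ?_⟩
  have hz0 : 0 < z := by linarith
  have a1 := h1 z hz
  have a2 := h2 z hz
  rw [show (ν + 2) / 2 + 1 / 4 = (ν / 2 + 1 / 4) + 1 by ring, add_mul _ 1, one_mul, ← sub_sub,
    Real.cos_sub_pi] at a2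
  have hs : 0 ≤ √(2 / (Real.pi * z)) := Real.sqrt_nonneg _
  have e1 : z ^ (-(3 / 2) : ℝ) = z ^ (-(1 / 2) : ℝ) / z := by
    rw [show (-(3/2) : ℝ) = -(1/2) - 1 by norm_num, Real.rpow_sub_one hz0.ne']
  have e2 : z ^ (-(3 / 2) : ℝ) ≤ z ^ (-(1 / 2) : ℝ) :=
    Real.rpow_le_rpow_of_exponent_le hz (by norm_num)
  have a3 : |besselJ (ν + 1) z| ≤ (√2 / √Real.pi + C1) * z ^ (-(1 / 2) : ℝ) := by
    have b1 : |√(2 / (Real.pi * z)) * Real.cos (z - ((ν + 1) / 2 + 1 / 4) * Real.pi)| ≤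
        √2 / √Real.pi * z ^ (-(1 / 2) : ℝ) := by
      rw [abs_mul, abs_of_nonneg hs, ← sqrt_eq z hz0]
      exact mul_le_of_le_one_right hs (Real.abs_cos_le_one _)
    have b2 := mul_le_mul_of_nonneg_left e2 hC1
    have b3 := abs_sub_abs_le_abs_sub (besselJ (ν + 1) z)
      (√(2 / (Real.pi * z)) * Real.cos (z - ((ν + 1) / 2 + 1 / 4) * Real.pi))
    linarith
  rw [besselJ_rec ν z hν hz0]
  have e3 : 2 * (ν + 1) / z * besselJ (ν + 1) z - besselJ (ν + 2) z -
      √(2 / (Real.pi * z)) * Real.cos (z - (ν / 2 + 1 / 4) * Real.pi) =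
      2 * (ν + 1) / z * besselJ (ν + 1) z - (besselJ (ν + 2) z -
      √(2 / (Real.pi * z)) * -Real.cos (z - (ν / 2 + 1 / 4) * Real.pi)) := by ring
  rw [e3]
  refine (abs_sub _ _).trans ?_
  have hq : 0 ≤ 2 * (ν + 1) / z := div_nonneg (by linarith) hz0.le
  rw [abs_mul, abs_of_nonneg hq, add_mul _ C2]
  refine add_le_add ?_ a2
  refine (mul_le_mul_of_nonneg_left a3 hq).trans (le_of_eq ?_)
  rw [e1]; ring

lemma besselP_all (ν : ℝ) (hν : -(1 / 2 : ℝ) ≤ ν) : BesselP ν := by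
  have h1 : ∀ ν : ℝ, 1 / 2 ≤ ν → BesselP ν := fun ν h =>
    besselP_down ν (by linarith) (besselP_large _ (by linarith)) (besselP_large _ (by linarith))
  exact besselP_down ν (by linarith) (h1 _ (by linarith)) (h1 _ (by linarith))

theorem stmt_10 (ν : ℝ) (hν : -(1 / 2 : ℝ) ≤ ν) :
    ∃ C : ℝ, 0 < C ∧ ∀ z : ℝ, 0 < z →
      |besselJ ν z - Real.sqrt (2 / (Real.pi * z)) * Real.cos (z - (ν / 2 + 1 / 4) * Real.pi)|
        ≤ C * z ^ (-(1 : ℝ) / 2) / Real.sqrt (1 + z ^ 2) := by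
  obtain ⟨C1, hC1, h1⟩ := besselP_all ν hν
  obtain ⟨C2, hC2, h2⟩ := besselJ_small ν hν
  have hpi : 0 < √Real.pi := Real.sqrt_pos.2 Real.pi_pos
  refine ⟨(C1 + C2 + √2 / √Real.pi) * 2, by positivity, fun z hz => ?_⟩
  have hS : 0 < √(1 + z ^ 2) := Real.sqrt_pos.2 (by positivity)
  have hS2 : √(1 + z ^ 2) ≤ 1 + z := Real.sqrt_le_iff.2 ⟨by positivity, by nlinarith⟩
  have hP : 0 < z ^ (-(1:ℝ) / 2) := by positivity
  rw [le_div_iff₀ hS]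
  have hk : 0 < √2 / √Real.pi := by positivity
  rcases le_total z 1 with hz1 | hz1
  · have a1 := h2 z hz hz1
    have b1 : |√(2 / (Real.pi * z)) * Real.cos (z - (ν / 2 + 1 / 4) * Real.pi)| ≤
        √2 / √Real.pi * z ^ (-(1:ℝ) / 2) := by
      rw [abs_mul, abs_of_nonneg (Real.sqrt_nonneg _), neg_div, ← sqrt_eq z hz]
      exact mul_le_of_le_one_right (Real.sqrt_nonneg _) (Real.abs_cos_le_one _)
    have b2 := (abs_sub (besselJ ν z)
      (√(2 / (Real.pi * z)) * Real.cos (z - (ν / 2 + 1 / 4) * Real.pi))).trans (add_le_add a1 b1)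
    calc _ ≤ (C2 * z ^ (-(1:ℝ) / 2) + √2 / √Real.pi * z ^ (-(1:ℝ) / 2)) * 2 :=
          mul_le_mul b2 (by linarith) hS.le (by positivity)
      _ ≤ _ := by nlinarith [mul_nonneg hC1 hP.le]
  · have a1 := h1 z hz1
    have e1 : z ^ (-(3 / 2) : ℝ) = z ^ (-(1:ℝ) / 2) / z := by
      rw [show (-(3/2) : ℝ) = -1/2 - 1 by norm_num, Real.rpow_sub_one hz.ne']
    rw [e1] at a1
    calc _ ≤ (C1 * (z ^ (-(1:ℝ) / 2) / z)) * (2 * z) :=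
          mul_le_mul a1 (by linarith) hS.le (by positivity)
      _ = C1 * z ^ (-(1:ℝ) / 2) * 2 := by field_simp
      _ ≤ _ := by nlinarith [mul_nonneg hC2 hP.le, mul_pos hk hP]
end

section
/- Let (A_n) and (B_n) be sequences of trace class operators on a Hilbert space such that ‖A_n - B_n‖₂ → 0 (Hilbert–Schmidt norm), the operators I + B_n are invertible with ‖(I + B_n)^{-1}‖ uniformly bounded, and tr((A_n - B_n)(I + B_n)^{-1}) → 0. Then det(I + A_n)/det(I + B_n) → 1 as n → ∞. -/
open scoped InnerProductSpace

variable {H : Type*} [NormedAddCommGroup H] [InnerProductSpace ℂ H] [CompleteSpace H]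

/-- A bounded operator on a Hilbert space is trace class (nuclear) if it admits a
representation `T x = ∑ₖ ⟪uₖ, x⟫ vₖ` with `∑ₖ ‖uₖ‖‖vₖ‖ < ∞`. -/
def IsTraceClass (T : H →L[ℂ] H) : Prop :=
  ∃ u v : ℕ → H, Summable (fun k => ‖u k‖ * ‖v k‖) ∧
    ∀ x, T x = ∑' k, ⟪u k, x⟫_ℂ • v k

/-- `TraceNormLT T c` asserts that `T` has a nuclear representation of total weight `< c`;
this holds for all `c` greater than the trace norm of `T`. -/
def TraceNormLT (T : H →L[ℂ] H) (c : ℝ) : Prop :=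
  ∃ u v : ℕ → H, Summable (fun k => ‖u k‖ * ‖v k‖) ∧
    (∀ x, T x = ∑' k, ⟪u k, x⟫_ℂ • v k) ∧ (∑' k, ‖u k‖ * ‖v k‖) < c

/-- The determinant `det(I + F)` of a finite-rank perturbation of the identity, computed
as the determinant of the restriction of `I + F` to the (invariant) range of `F`. -/
noncomputable def finRankDet (F : H →L[ℂ] H) : ℂ :=
  LinearMap.det ((LinearMap.id + (F : H →ₗ[ℂ] H)).restrict
    (p := LinearMap.range (F : H →ₗ[ℂ] H)) (q := LinearMap.range (F : H →ₗ[ℂ] H))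
    (fun x hx => by
      simp only [LinearMap.add_apply, LinearMap.id_apply]
      exact Submodule.add_mem _ hx (LinearMap.mem_range_self _ x)))

/-- `IsFredholmDet fdet` asserts that `T ↦ fdet T` agrees with the finite-dimensional
determinant `det(I + F)` on finite-rank operators `F` and is continuous in the trace
norm on trace class operators.  These properties characterize the Fredholm determinant
`fdet T = det(I + T)` on trace class operators. -/
def IsFredholmDet (fdet : (H →L[ℂ] H) → ℂ) : Prop :=
  (∀ F : H →L[ℂ] H, FiniteDimensional ℂ (LinearMap.range (F : H →ₗ[ℂ] H)) →
      fdet F = finRankDet F) ∧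
  (∀ T : H →L[ℂ] H, IsTraceClass T → ∀ ε > (0 : ℝ), ∃ δ > (0 : ℝ),
      ∀ S : H →L[ℂ] H, IsTraceClass S → TraceNormLT (S - T) δ → ‖fdet S - fdet T‖ < ε)

/-- `IsOperatorTrace tr` asserts that `tr` computes the trace `∑ₖ ⟪uₖ, vₖ⟫` of any
trace class operator given by a nuclear representation. -/
def IsOperatorTrace (tr : (H →L[ℂ] H) → ℂ) : Prop :=
  ∀ (T : H →L[ℂ] H) (u v : ℕ → H), Summable (fun k => ‖u k‖ * ‖v k‖) →
    (∀ x, T x = ∑' k, ⟪u k, x⟫_ℂ • v k) → tr T = ∑' k, ⟪u k, v k⟫_ℂ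

open Filter


section MatrixEstimate

open Matrix Filter
open scoped ComplexOrder

/-- Carleman type inequality for matrices. -/
lemma aux_norm_det_le {N : ℕ} (c : Matrix (Fin N) (Fin N) ℂ) :
    ‖(1 + c).det * Complex.exp (-c.trace)‖ ≤ Real.exp ((∑ i, ∑ j, ‖c i j‖ ^ 2) / 2) := by
  have hP : ((1 + c)ᴴ * (1 + c)).PosSemidef := Matrix.posSemidef_conjTranspose_mul_self _
  have hH := hP.isHermitian
  have hdet : ‖(1 + c).det‖ ^ 2 = ∏ i, hH.eigenvalues i := by
    have h1 := hH.det_eq_prod_eigenvalues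
    rw [Matrix.det_mul, Matrix.det_conjTranspose] at h1
    have h2 : ((‖(1 + c).det‖ ^ 2 : ℝ) : ℂ) = ((∏ i, hH.eigenvalues i : ℝ) : ℂ) := by
      push_cast
      rw [← Complex.conj_mul']
      simpa using h1
    exact_mod_cast h2
  have htr : ∑ i, (hH.eigenvalues i - 1) = 2 * c.trace.re + ∑ i, ∑ j, ‖c i j‖ ^ 2 := by
    have h1 := hH.trace_eq_sum_eigenvalues
    have h3 : ((1 + c)ᴴ * (1 + c)).trace = (N : ℂ) + c.trace + star c.trace
        + ((∑ i, ∑ j, ‖c i j‖ ^ 2 : ℝ) : ℂ) := by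
      have h4 : (cᴴ * c).trace = ((∑ i, ∑ j, ‖c i j‖ ^ 2 : ℝ) : ℂ) := by
        rw [Finset.sum_comm]
        simp only [Matrix.trace, Matrix.diag, Matrix.mul_apply, Matrix.conjTranspose_apply]
        push_cast
        refine Finset.sum_congr rfl fun i _ => Finset.sum_congr rfl fun j _ => ?_
        rw [← Complex.conj_mul']; rfl
      rw [← h4, Matrix.conjTranspose_add, Matrix.conjTranspose_one, add_mul, mul_add, one_mul,
        mul_add, one_mul, mul_one]
      simp only [Matrix.trace_add, Matrix.trace_one, Fintype.card_fin,
        Matrix.trace_conjTranspose]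
      ring
    rw [h3] at h1
    have h5 := congrArg Complex.re h1
    simp only [Complex.add_re, Complex.natCast_re, Complex.ofReal_re, Complex.re_sum] at h5
    have h6 : (star c.trace).re = c.trace.re := Complex.conj_re _
    rw [h6] at h5
    simp only [Finset.sum_sub_distrib, Finset.sum_const, Finset.card_univ, Fintype.card_fin,
      nsmul_eq_mul, mul_one]
    have h7 : ∑ i, (((hH.eigenvalues i : ℝ) : ℂ)).re = ∑ i, hH.eigenvalues i := by simp
    have h8 : (∑ i, hH.eigenvalues i) = N + c.trace.re + c.trace.re + ∑ i, ∑ j, ‖c i j‖ ^ 2 := by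
      rw [← h7]; exact h5.symm
    rw [h8]; ring
  have hle : ‖(1 + c).det‖ ^ 2 ≤ Real.exp (2 * c.trace.re + ∑ i, ∑ j, ‖c i j‖ ^ 2) := by
    rw [hdet, ← htr, Real.exp_sum]
    refine Finset.prod_le_prod (fun i _ => hP.eigenvalues_nonneg i) fun i _ => ?_
    have := Real.add_one_le_exp (hH.eigenvalues i - 1)
    linarith
  rw [norm_mul, Complex.norm_exp, Complex.neg_re]
  refine le_of_sq_le_sq ?_ (Real.exp_pos _).le
  rw [mul_pow, ← Real.exp_nat_mul, ← Real.exp_nat_mul]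
  calc _ ≤ Real.exp (2 * c.trace.re + ∑ i, ∑ j, ‖c i j‖ ^ 2) * Real.exp ((2 : ℕ) * -c.trace.re) := by
        gcongr
    _ = _ := by
        rw [← Real.exp_add]; congr 1; push_cast; ring

lemma aux_matrix_estimate {N : ℕ} (c : Matrix (Fin N) (Fin N) ℂ) (s : ℝ) (hs : 0 < s) (hs1 : s < 1)
    (hc : ∑ i, ∑ j, ‖c i j‖ ^ 2 ≤ s ^ 2) :
    ‖(1 + c).det * Complex.exp (-c.trace) - 1‖ ≤ 3 * s := by
  set g : ℂ → ℂ := fun z => (1 + z • c).det * Complex.exp (-(z * c.trace)) with hg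
  have hd : Differentiable ℂ g := by
    refine Differentiable.mul ?_ (by fun_prop)
    simp only [Matrix.det_apply]
    refine Differentiable.fun_sum fun σ _ => ?_
    refine Differentiable.const_smul ?_ _
    refine Differentiable.fun_finsetProd fun i _ => ?_
    simp only [Matrix.add_apply, Matrix.smul_apply]
    fun_prop
  have h0 : g 0 = 1 := by simp [hg]
  have hmaps : Set.MapsTo g (Metric.ball 0 (1 / s)) (Metric.closedBall (g 0) 3) := by
    intro z hz
    rw [h0, mem_closedBall_iff_norm]
    have hz' : ‖z‖ * s ≤ 1 := by
      rw [mem_ball_zero_iff, lt_div_iff₀ hs] at hz; exact hz.le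
    have h1 : ‖g z‖ ≤ Real.exp ((∑ i, ∑ j, ‖(z • c) i j‖ ^ 2) / 2) := by
      have := aux_norm_det_le (z • c)
      simpa only [hg, Matrix.trace_smul, smul_eq_mul] using this
    have h2 : ∑ i, ∑ j, ‖(z • c) i j‖ ^ 2 ≤ 1 := by
      have : ∑ i, ∑ j, ‖(z • c) i j‖ ^ 2 = ‖z‖ ^ 2 * ∑ i, ∑ j, ‖c i j‖ ^ 2 := by
        simp only [Matrix.smul_apply, smul_eq_mul, norm_mul, mul_pow, Finset.mul_sum]
      rw [this]
      calc _ ≤ ‖z‖ ^ 2 * s ^ 2 := by gcongr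
        _ = (‖z‖ * s) ^ 2 := by ring
        _ ≤ 1 := pow_le_one₀ (by positivity) hz'
    have h3 : Real.exp ((∑ i, ∑ j, ‖(z • c) i j‖ ^ 2) / 2) ≤ 2 := by
      calc _ ≤ Real.exp (1 / 2) := by gcongr
        _ ≤ 2 := by
          have h := Real.exp_one_lt_d9
          have h' : Real.exp (1 / 2) ^ 2 = Real.exp 1 := by
            rw [← Real.exp_nat_mul]; norm_num
          nlinarith [Real.exp_pos (1 / 2)]
    calc ‖g z - 1‖ ≤ ‖g z‖ + ‖(1 : ℂ)‖ := norm_sub_le _ _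
      _ ≤ 3 := by rw [norm_one]; linarith
  have h1 : (1 : ℂ) ∈ Metric.ball (0 : ℂ) (1 / s) := by
    rw [mem_ball_zero_iff, norm_one, lt_div_iff₀ hs]; linarith
  have := Complex.dist_le_div_mul_dist_of_mapsTo_ball hd.differentiableOn hmaps h1
  rw [h0, dist_eq_norm, dist_zero_right, norm_one] at this
  simpa [hg] using this

end MatrixEstimate

section FiniteRank

variable {E : Type*} [AddCommGroup E] [Module ℂ E]

/-- determinant of `1 + F` on a submodule containing the range -/
noncomputable def auxDet (F : E →ₗ[ℂ] E) (W : Submodule ℂ E) (h : LinearMap.range F ≤ W) : ℂ :=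
  LinearMap.det ((LinearMap.id + F).restrict (p := W) (q := W)
    (fun x hx => Submodule.add_mem _ hx (h (LinearMap.mem_range_self _ x))))

lemma aux_det_eq (F : E →ₗ[ℂ] E) (W : Submodule ℂ E) [FiniteDimensional ℂ W]
    (h : LinearMap.range F ≤ W) : auxDet F W h = auxDet F (LinearMap.range F) le_rfl := by
  unfold auxDet
  set e : W →ₗ[ℂ] W := (LinearMap.id + F).restrict (p := W) (q := W)
    (fun x hx => Submodule.add_mem _ hx (h (LinearMap.mem_range_self _ x))) with he
  set R : Submodule ℂ W := (LinearMap.range F).comap W.subtype with hR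
  have hRe : R ≤ R.comap e := by
    intro x hx
    change (x : E) + F x ∈ LinearMap.range F
    exact Submodule.add_mem _ hx (LinearMap.mem_range_self _ _)
  rw [LinearMap.det_eq_det_mul_det R e hRe]
  have hq : R.mapQ R e hRe = LinearMap.id := by
    ext x
    simp only [LinearMap.comp_apply, Submodule.mkQ_apply, Submodule.mapQ_apply, LinearMap.id_apply]
    rw [Submodule.Quotient.eq]
    change ((x : E) + F x) - x ∈ LinearMap.range F
    simp
  rw [hq, LinearMap.det_id, mul_one]
  let φ : R ≃ₗ[ℂ] LinearMap.range F := Submodule.comapSubtypeEquivOfLe h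
  rw [← LinearMap.det_conj (e.restrict hRe) φ]
  congr 1

lemma aux_det_mul (F G K : E →ₗ[ℂ] E) (hK : LinearMap.id + K = (LinearMap.id + F) ∘ₗ (LinearMap.id + G))
    (W : Submodule ℂ E) (hF : LinearMap.range F ≤ W) (hG : LinearMap.range G ≤ W)
    (hKW : LinearMap.range K ≤ W) : auxDet K W hKW = auxDet F W hF * auxDet G W hG := by
  unfold auxDet
  rw [← LinearMap.det_comp]
  congr 1
  ext x
  have := LinearMap.congr_fun hK x
  simpa using this

lemma aux_det_matrix {N : ℕ} (c : Matrix (Fin N) (Fin N) ℂ) (ι : (Fin N → ℂ) →ₗ[ℂ] E)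
    (π : E →ₗ[ℂ] (Fin N → ℂ)) (hπ : π ∘ₗ ι = LinearMap.id) (F : E →ₗ[ℂ] E)
    (hF : F = ι ∘ₗ Matrix.toLin' c ∘ₗ π) (h : LinearMap.range F ≤ LinearMap.range ι) :
    auxDet F (LinearMap.range ι) h = (1 + c).det := by
  have hinj : Function.Injective ι := by
    intro x y hxy
    have := congrArg π hxy
    simpa using (LinearMap.congr_fun hπ x).symm.trans (this.trans (LinearMap.congr_fun hπ y))
  let φ := LinearEquiv.ofInjective ι hinj
  rw [← LinearMap.det_toLin' (1 + c), ← LinearMap.det_conj _ φ]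
  unfold auxDet
  congr 1
  ext x
  obtain ⟨y, rfl⟩ := φ.surjective x
  have hy : ((φ y : LinearMap.range ι) : E) = ι y := rfl
  have h1 : π (ι y) = y := LinearMap.congr_fun hπ y
  simp only [LinearMap.comp_apply, LinearEquiv.coe_coe, LinearEquiv.symm_apply_apply]
  change ((φ y : LinearMap.range ι) : E) + F (φ y : LinearMap.range ι) = ι _
  rw [hy, hF]
  simp [h1, Matrix.add_mulVec]

end FiniteRank

section Nuclear

lemma aux_hasSum {u v : ℕ → H} (hs : Summable (fun k => ‖u k‖ * ‖v k‖)) (x : H) :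
    Summable (fun k => ⟪u k, x⟫_ℂ • v k) := by
  refine Summable.of_norm_bounded (hs.mul_right ‖x‖) fun k => ?_
  rw [norm_smul]
  calc _ ≤ (‖u k‖ * ‖x‖) * ‖v k‖ := by gcongr; exact norm_inner_le_norm _ _
    _ = _ := by ring

lemma aux_inner_summable {u v : ℕ → H} (hs : Summable (fun k => ‖u k‖ * ‖v k‖)) :
    Summable (fun k => ⟪u k, v k⟫_ℂ) :=
  Summable.of_norm_bounded hs fun k => norm_inner_le_norm _ _

lemma aux_weight_le {u v : ℕ → H} (hs : Summable (fun k => ‖u k‖ * ‖v k‖)) {u' v' : ℕ → H} {M : ℝ}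
    (h : ∀ k, ‖u' k‖ * ‖v' k‖ ≤ (‖u k‖ * ‖v k‖) * M) :
    Summable (fun k => ‖u' k‖ * ‖v' k‖) ∧
      ∑' k, ‖u' k‖ * ‖v' k‖ ≤ (∑' k, ‖u k‖ * ‖v k‖) * M := by
  have h1 : Summable (fun k => ‖u' k‖ * ‖v' k‖) :=
    Summable.of_nonneg_of_le (fun k => by positivity) h (hs.mul_right M)
  refine ⟨h1, ?_⟩
  rw [← tsum_mul_right]
  exact h1.tsum_le_tsum h (hs.mul_right M)

lemma aux_rep_left {T : H →L[ℂ] H} {u v : ℕ → H} (hs : Summable (fun k => ‖u k‖ * ‖v k‖))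
    (hT : ∀ x, T x = ∑' k, ⟪u k, x⟫_ℂ • v k) (X : H →L[ℂ] H) :
    ∀ x, (X * T) x = ∑' k, ⟪u k, x⟫_ℂ • X (v k) := by
  intro x
  rw [mul_apply_eq_comp, hT, X.map_tsum (aux_hasSum hs x)]
  simp

lemma aux_rep_right {T : H →L[ℂ] H} {u v : ℕ → H}
    (hT : ∀ x, T x = ∑' k, ⟪u k, x⟫_ℂ • v k) (X : H →L[ℂ] H) :
    ∀ x, (T * X) x = ∑' k, ⟪X.adjoint (u k), x⟫_ℂ • v k := by
  intro x
  rw [mul_apply_eq_comp, hT]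
  simp [ContinuousLinearMap.adjoint_inner_left]

lemma aux_TN_left {T : H →L[ℂ] H} {c : ℝ} (h : TraceNormLT T c) (X : H →L[ℂ] H) {M : ℝ}
    (hM : 0 < M) (hX : ‖X‖ ≤ M) : TraceNormLT (X * T) (c * M) := by
  obtain ⟨u, v, hs, hT, hc⟩ := h
  have := aux_weight_le hs (u' := u) (v' := fun k => X (v k)) (M := M) (fun k => by
    calc _ ≤ ‖u k‖ * (M * ‖v k‖) := by gcongr; exact X.le_of_opNorm_le hX _
      _ = _ := by ring)
  exact ⟨u, fun k => X (v k), this.1, aux_rep_left hs hT X,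
    this.2.trans_lt (mul_lt_mul_of_pos_right hc hM)⟩

lemma aux_TN_right {T : H →L[ℂ] H} {c : ℝ} (h : TraceNormLT T c) (X : H →L[ℂ] H) {M : ℝ}
    (hM : 0 < M) (hX : ‖X‖ ≤ M) : TraceNormLT (T * X) (c * M) := by
  obtain ⟨u, v, hs, hT, hc⟩ := h
  have hX' : ‖X.adjoint‖ ≤ M := by rwa [LinearIsometryEquiv.norm_map]
  have := aux_weight_le hs (u' := fun k => X.adjoint (u k)) (v' := v) (M := M) (fun k => by
    calc _ ≤ (M * ‖u k‖) * ‖v k‖ := by gcongr; exact X.adjoint.le_of_opNorm_le hX' _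
      _ = _ := by ring)
  exact ⟨fun k => X.adjoint (u k), v, this.1, aux_rep_right hT X,
    this.2.trans_lt (mul_lt_mul_of_pos_right hc hM)⟩

lemma aux_TN_add {S T : H →L[ℂ] H} {a b : ℝ} (hS : TraceNormLT S a) (hT : TraceNormLT T b) :
    TraceNormLT (S + T) (a + b) := by
  obtain ⟨u, v, hs, hS, ha⟩ := hS
  obtain ⟨u', v', hs', hT, hb⟩ := hT
  let φ := Equiv.natSumNatEquivNat
  have key : HasSum ((fun k => ‖Sum.elim u u' (φ.symm k)‖ * ‖Sum.elim v v' (φ.symm k)‖))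
      ((∑' k, ‖u k‖ * ‖v k‖) + (∑' k, ‖u' k‖ * ‖v' k‖)) := by
    refine (φ.symm.hasSum_iff (f := fun k => ‖Sum.elim u u' k‖ * ‖Sum.elim v v' k‖)).2 ?_
    exact HasSum.sum hs.hasSum hs'.hasSum
  refine ⟨fun k => Sum.elim u u' (φ.symm k), fun k => Sum.elim v v' (φ.symm k), key.summable,
    fun x => ?_, ?_⟩
  · have : HasSum (fun k => ⟪Sum.elim u u' (φ.symm k), x⟫_ℂ • Sum.elim v v' (φ.symm k))
        (S x + T x) := by
      refine (φ.symm.hasSum_iff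
        (f := fun k => ⟪Sum.elim u u' k, x⟫_ℂ • Sum.elim v v' k)).2 ?_
      rw [hS, hT]
      exact HasSum.sum (aux_hasSum hs x).hasSum (aux_hasSum hs' x).hasSum
    exact this.tsum_eq.symm
  · rw [key.tsum_eq]; linarith

lemma aux_TC_iff {T : H →L[ℂ] H} : IsTraceClass T ↔ ∃ c, TraceNormLT T c := by
  constructor
  · rintro ⟨u, v, hs, hT⟩
    exact ⟨_, u, v, hs, hT, lt_add_one _⟩
  · rintro ⟨c, u, v, hs, hT, -⟩
    exact ⟨u, v, hs, hT⟩

lemma aux_TC_add {S T : H →L[ℂ] H} (hS : IsTraceClass S) (hT : IsTraceClass T) :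
    IsTraceClass (S + T) := by
  obtain ⟨a, ha⟩ := aux_TC_iff.1 hS
  obtain ⟨b, hb⟩ := aux_TC_iff.1 hT
  exact aux_TC_iff.2 ⟨_, aux_TN_add ha hb⟩

lemma aux_TC_left {T : H →L[ℂ] H} (hT : IsTraceClass T) (X : H →L[ℂ] H) :
    IsTraceClass (X * T) := by
  obtain ⟨b, hb⟩ := aux_TC_iff.1 hT
  exact aux_TC_iff.2 ⟨_, aux_TN_left hb X (M := ‖X‖ + 1) (by positivity) (by linarith)⟩

lemma aux_TC_right {T : H →L[ℂ] H} (hT : IsTraceClass T) (X : H →L[ℂ] H) :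
    IsTraceClass (T * X) := by
  obtain ⟨b, hb⟩ := aux_TC_iff.1 hT
  exact aux_TC_iff.2 ⟨_, aux_TN_right hb X (M := ‖X‖ + 1) (by positivity) (by linarith)⟩

lemma aux_TC_neg {T : H →L[ℂ] H} (hT : IsTraceClass T) : IsTraceClass (-T) := by
  have := aux_TC_left hT (-1)
  simpa using this

/-- Convergence in trace norm. -/
def AuxTend (S : ℕ → H →L[ℂ] H) (T : H →L[ℂ] H) : Prop :=
  ∀ δ > (0 : ℝ), ∀ᶠ n in atTop, TraceNormLT (S n - T) δ

lemma aux_tend_add {S S' : ℕ → H →L[ℂ] H} {T T' : H →L[ℂ] H} (h : AuxTend S T)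
    (h' : AuxTend S' T') : AuxTend (fun n => S n + S' n) (T + T') := by
  intro δ hδ
  filter_upwards [h (δ / 2) (by positivity), h' (δ / 2) (by positivity)] with n h1 h2
  have := aux_TN_add h1 h2
  rwa [add_halves, sub_add_sub_comm] at this

lemma aux_tend_mul {S S' : ℕ → H →L[ℂ] H} {T T' : H →L[ℂ] H} (h : AuxTend S T)
    (h' : AuxTend S' T') {M : ℝ} (hM : ∀ n, ‖S' n‖ ≤ M) :
    AuxTend (fun n => S n * S' n) (T * T') := by
  intro δ hδ
  have hM0 : 0 ≤ M := (norm_nonneg _).trans (hM 0)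
  have hT0 : 0 ≤ ‖T‖ := norm_nonneg _
  filter_upwards [h (δ / 2 / (M + 1)) (by positivity), h' (δ / 2 / (‖T‖ + 1)) (by positivity)]
    with n h1 h2
  have h3 := aux_TN_right h1 (S' n) (M := M + 1) (by positivity) (by linarith [hM n])
  have h4 := aux_TN_left h2 T (M := ‖T‖ + 1) (by positivity) (by linarith)
  rw [div_mul_cancel₀ _ (by positivity)] at h3 h4
  have := aux_TN_add h3 h4
  rw [add_halves] at this
  convert this using 1
  noncomm_ring

lemma aux_tend_fdet {fdet : (H →L[ℂ] H) → ℂ} (hdet : IsFredholmDet fdet)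
    {S : ℕ → H →L[ℂ] H} {T : H →L[ℂ] H} (hS : ∀ n, IsTraceClass (S n)) (hT : IsTraceClass T)
    (h : AuxTend S T) : Tendsto (fun n => fdet (S n)) atTop (nhds (fdet T)) := by
  rw [Metric.tendsto_nhds]
  intro ε hε
  obtain ⟨δ, hδ, H'⟩ := hdet.2 T hT ε hε
  filter_upwards [h δ hδ] with n hn
  rw [dist_eq_norm]
  exact H' _ (hS n) hn

/-- The projection onto the first `N` basis vectors. -/
noncomputable def auxP (e : HilbertBasis ℕ ℂ H) (N : ℕ) : H →L[ℂ] H :=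
  ∑ i : Fin N, (innerSL ℂ (e i)).smulRight (e i)

lemma auxP_apply (e : HilbertBasis ℕ ℂ H) (N : ℕ) (x : H) :
    auxP e N x = ∑ i : Fin N, ⟪e i, x⟫_ℂ • e i := by
  simp [auxP]

lemma auxP_symm (e : HilbertBasis ℕ ℂ H) (N : ℕ) (x y : H) :
    ⟪auxP e N x, y⟫_ℂ = ⟪x, auxP e N y⟫_ℂ := by
  simp only [auxP_apply, sum_inner, inner_sum, inner_smul_left, inner_smul_right, inner_conj_symm]
  exact Finset.sum_congr rfl fun i _ => mul_comm _ _

lemma auxP_adjoint (e : HilbertBasis ℕ ℂ H) (N : ℕ) : (auxP e N).adjoint = auxP e N := by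
  symm
  rw [ContinuousLinearMap.eq_adjoint_iff]
  exact auxP_symm e N

lemma aux_orth (e : HilbertBasis ℕ ℂ H) (N : ℕ) : Orthonormal ℂ (fun i : Fin N => e i) :=
  e.orthonormal.comp _ Fin.val_injective

lemma auxP_idem (e : HilbertBasis ℕ ℂ H) (N : ℕ) (x : H) : auxP e N (auxP e N x) = auxP e N x := by
  rw [auxP_apply e N (auxP e N x)]
  conv_rhs => rw [auxP_apply]
  refine Finset.sum_congr rfl fun i _ => ?_
  rw [auxP_apply, (aux_orth e N).inner_right_fintype]

lemma auxP_norm (e : HilbertBasis ℕ ℂ H) (N : ℕ) : ‖auxP e N‖ ≤ 1 := by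
  refine ContinuousLinearMap.opNorm_le_bound _ zero_le_one fun x => ?_
  rw [one_mul]
  have h1 : ‖auxP e N x‖ ^ 2 ≤ ‖auxP e N x‖ * ‖x‖ := by
    have : ⟪auxP e N x, x⟫_ℂ = ((‖auxP e N x‖ ^ 2 : ℝ) : ℂ) := by
      rw [← auxP_idem, auxP_symm, inner_self_eq_norm_sq_to_K, auxP_idem]
      simp
    have h2 := norm_inner_le_norm (𝕜 := ℂ) (auxP e N x) x
    rw [this, Complex.norm_real, Real.norm_of_nonneg (by positivity)] at h2
    exact h2
  by_contra! hlt
  nlinarith [norm_nonneg x]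

lemma auxP_tendsto (e : HilbertBasis ℕ ℂ H) (x : H) :
    Tendsto (fun N => auxP e N x) atTop (nhds x) := by
  have := (e.hasSum_repr x).tendsto_sum_nat
  refine this.congr fun N => ?_
  rw [auxP_apply, Finset.sum_range]
  simp [HilbertBasis.repr_apply_apply]

lemma auxP_sub_norm (e : HilbertBasis ℕ ℂ H) (N : ℕ) (x : H) : ‖auxP e N x - x‖ ≤ 2 * ‖x‖ := by
  have h1 := (auxP e N).le_of_opNorm_le (auxP_norm e N) x
  have := norm_sub_le (auxP e N x) x
  linarith

lemma auxP_sub_tendsto (e : HilbertBasis ℕ ℂ H) (x : H) :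
    Tendsto (fun N => ‖auxP e N x - x‖) atTop (nhds 0) := by
  have := ((auxP_tendsto e x).sub_const x).norm
  simpa using this

lemma aux_trunc_tend (e : HilbertBasis ℕ ℂ H) {T : H →L[ℂ] H} (hT : IsTraceClass T) :
    AuxTend (fun N => auxP e N * T * auxP e N) T := by
  obtain ⟨u, v, hs, hT⟩ := hT
  have h1 : Tendsto (fun N => ∑' k, ‖u k‖ * ‖auxP e N (v k) - v k‖) atTop (nhds 0) := by
    have := tendsto_tsum_of_dominated_convergence (𝓕 := atTop)
      (f := fun N k => ‖u k‖ * ‖auxP e N (v k) - v k‖) (g := fun _ => 0) (hs.mul_left 2)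
      (fun k => by simpa using (auxP_sub_tendsto e (v k)).const_mul ‖u k‖)
      (Eventually.of_forall fun N k => by
        rw [Real.norm_of_nonneg (by positivity)]
        calc _ ≤ ‖u k‖ * (2 * ‖v k‖) := by gcongr; exact auxP_sub_norm e N _
          _ = _ := by ring)
    simpa using this
  have h2 : Tendsto (fun N => ∑' k, ‖auxP e N (u k) - u k‖ * ‖v k‖) atTop (nhds 0) := by
    have := tendsto_tsum_of_dominated_convergence (𝓕 := atTop)
      (f := fun N k => ‖auxP e N (u k) - u k‖ * ‖v k‖) (g := fun _ => 0) (hs.mul_left 2)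
      (fun k => by simpa using (auxP_sub_tendsto e (u k)).mul_const ‖v k‖)
      (Eventually.of_forall fun N k => by
        rw [Real.norm_of_nonneg (by positivity)]
        calc _ ≤ (2 * ‖u k‖) * ‖v k‖ := by gcongr; exact auxP_sub_norm e N _
          _ = _ := by ring)
    simpa using this
  intro δ hδ
  filter_upwards [h1.eventually_lt_const (half_pos hδ), h2.eventually_lt_const (half_pos hδ)]
    with N hN1 hN2
  have a1 : TraceNormLT ((auxP e N - 1) * T) (δ / 2) := by
    refine ⟨u, fun k => auxP e N (v k) - v k, ?_, ?_, hN1⟩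
    · refine (aux_weight_le hs (M := 2) fun k => ?_).1
      calc _ ≤ ‖u k‖ * (2 * ‖v k‖) := by gcongr; exact auxP_sub_norm e N _
          _ = _ := by ring
    · exact aux_rep_left hs hT _
  have a2 : TraceNormLT (T * (auxP e N - 1)) (δ / 2) := by
    refine ⟨fun k => auxP e N (u k) - u k, v, ?_, ?_, hN2⟩
    · refine (aux_weight_le hs (M := 2) fun k => ?_).1
      calc _ ≤ (2 * ‖u k‖) * ‖v k‖ := by gcongr; exact auxP_sub_norm e N _
          _ = _ := by ring
    · intro x
      rw [aux_rep_right hT]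
      have : (auxP e N - 1).adjoint = auxP e N - 1 := by
        rw [map_sub, auxP_adjoint]
        congr 1
        exact ContinuousLinearMap.adjoint_id
      rw [this]; rfl
  have a3 := aux_TN_add a1 (aux_TN_left a2 (auxP e N) one_pos (auxP_norm e N))
  rw [mul_one, add_halves] at a3
  convert a3 using 1
  noncomm_ring

lemma aux_trunc_norm (e : HilbertBasis ℕ ℂ H) (T : H →L[ℂ] H) (N : ℕ) :
    ‖auxP e N * T * auxP e N‖ ≤ ‖T‖ := by
  have h := auxP_norm e N
  calc _ ≤ ‖auxP e N * T‖ * ‖auxP e N‖ := norm_mul_le _ _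
    _ ≤ (‖auxP e N‖ * ‖T‖) * ‖auxP e N‖ := by gcongr; exact norm_mul_le _ _
    _ ≤ (1 * ‖T‖) * 1 := by gcongr
    _ = _ := by ring

end Nuclear

section Main

/-- The inclusion of the span of the first `N` basis vectors. -/
noncomputable def auxI (e : HilbertBasis ℕ ℂ H) (N : ℕ) : (Fin N → ℂ) →ₗ[ℂ] H :=
  Fintype.linearCombination ℂ (fun i : Fin N => e i)

/-- The coordinates with respect to the first `N` basis vectors. -/
noncomputable def auxC (e : HilbertBasis ℕ ℂ H) (N : ℕ) : H →ₗ[ℂ] (Fin N → ℂ) :=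
  LinearMap.pi (fun i : Fin N => (innerSL ℂ (e i)).toLinearMap)

lemma auxI_apply (e : HilbertBasis ℕ ℂ H) (N : ℕ) (x : Fin N → ℂ) :
    auxI e N x = ∑ i, x i • e i := by
  simp [auxI, Fintype.linearCombination_apply]

lemma auxC_apply (e : HilbertBasis ℕ ℂ H) (N : ℕ) (x : H) (i : Fin N) :
    auxC e N x i = ⟪e i, x⟫_ℂ := by
  simp [auxC]

lemma auxCI (e : HilbertBasis ℕ ℂ H) (N : ℕ) : auxC e N ∘ₗ auxI e N = LinearMap.id := by
  refine LinearMap.ext fun x => funext fun i => ?_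
  rw [LinearMap.comp_apply, auxC_apply, auxI_apply, (aux_orth e N).inner_right_fintype]
  rfl

lemma auxIC (e : HilbertBasis ℕ ℂ H) (N : ℕ) (x : H) : auxI e N (auxC e N x) = auxP e N x := by
  rw [auxI_apply, auxP_apply]
  simp only [auxC_apply]

lemma aux_fdet_eq {fdet : (H →L[ℂ] H) → ℂ} (hdet : IsFredholmDet fdet) (F : H →L[ℂ] H)
    (W : Submodule ℂ H) [FiniteDimensional ℂ W] (h : LinearMap.range (F : H →ₗ[ℂ] H) ≤ W) :
    fdet F = auxDet (F : H →ₗ[ℂ] H) W h := by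
  rw [hdet.1 F (Submodule.finiteDimensional_of_le h), aux_det_eq]
  rfl

lemma aux_range (e : HilbertBasis ℕ ℂ H) (N : ℕ) (X : H →L[ℂ] H) :
    LinearMap.range ((auxP e N * X : H →L[ℂ] H) : H →ₗ[ℂ] H) ≤ LinearMap.range (auxI e N) := by
  rintro _ ⟨x, rfl⟩
  exact ⟨auxC e N (X x), auxIC e N _⟩

lemma aux_fdet_zero {fdet : (H →L[ℂ] H) → ℂ} (hdet : IsFredholmDet fdet) : fdet 0 = 1 := by
  rw [aux_fdet_eq hdet 0 ⊥ (by rintro _ ⟨x, rfl⟩; simp)]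
  unfold auxDet
  rw [← LinearMap.det_id (M := (⊥ : Submodule ℂ H)) (A := ℂ)]
  congr 1
  ext x

lemma aux_fdet_mul (e : HilbertBasis ℕ ℂ H) {fdet : (H →L[ℂ] H) → ℂ} (hdet : IsFredholmDet fdet)
    {A B : H →L[ℂ] H} (hA : IsTraceClass A) (hB : IsTraceClass B) :
    fdet (A + B + A * B) = fdet A * fdet B := by
  set a : ℕ → H →L[ℂ] H := fun N => auxP e N * A * auxP e N with ha
  set b : ℕ → H →L[ℂ] H := fun N => auxP e N * B * auxP e N with hb
  have tA := aux_trunc_tend e hA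
  have tB := aux_trunc_tend e hB
  have cA : ∀ N, IsTraceClass (a N) := fun N => aux_TC_right (aux_TC_left hA _) _
  have cB : ∀ N, IsTraceClass (b N) := fun N => aux_TC_right (aux_TC_left hB _) _
  have tK : AuxTend (fun N => a N + b N + a N * b N) (A + B + A * B) :=
    aux_tend_add (aux_tend_add tA tB) (aux_tend_mul tA tB (aux_trunc_norm e B))
  have l1 := aux_tend_fdet hdet (fun N => aux_TC_add (aux_TC_add (cA N) (cB N))
    (aux_TC_right (cA N) (b N))) (aux_TC_add (aux_TC_add hA hB) (aux_TC_right hA B)) tK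
  have l2 := (aux_tend_fdet hdet cA hA tA).mul (aux_tend_fdet hdet cB hB tB)
  refine tendsto_nhds_unique l1 (l2.congr fun N => ?_)
  have r1 : LinearMap.range (a N : H →ₗ[ℂ] H) ≤ LinearMap.range (auxI e N) := by
    have := aux_range e N (A * auxP e N)
    rwa [← mul_assoc] at this
  have r2 : LinearMap.range (b N : H →ₗ[ℂ] H) ≤ LinearMap.range (auxI e N) := by
    have := aux_range e N (B * auxP e N)
    rwa [← mul_assoc] at this
  have r3 : LinearMap.range ((a N + b N + a N * b N : H →L[ℂ] H) : H →ₗ[ℂ] H) ≤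
      LinearMap.range (auxI e N) := by
    rintro _ ⟨x, rfl⟩
    exact Submodule.add_mem _ (Submodule.add_mem _ (r1 ⟨x, rfl⟩) (r2 ⟨x, rfl⟩)) (r1 ⟨b N x, rfl⟩)
  rw [aux_fdet_eq hdet _ _ r1, aux_fdet_eq hdet _ _ r2, aux_fdet_eq hdet _ _ r3]
  refine (aux_det_mul _ _ _ ?_ _ r1 r2 r3).symm
  ext x
  change x + (a N x + b N x + a N (b N x)) = (x + b N x) + a N (x + b N x)
  rw [map_add]; abel

/-- The matrix of an operator in the first `N` basis vectors. -/
noncomputable def auxM (e : HilbertBasis ℕ ℂ H) (T : H →L[ℂ] H) (N : ℕ) :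
    Matrix (Fin N) (Fin N) ℂ := Matrix.of fun i j => ⟪e i, T (e j)⟫_ℂ

lemma aux_fdet_trunc (e : HilbertBasis ℕ ℂ H) {fdet : (H →L[ℂ] H) → ℂ} (hdet : IsFredholmDet fdet)
    (T : H →L[ℂ] H) (N : ℕ) : fdet (auxP e N * T * auxP e N) = (1 + auxM e T N).det := by
  have r1 : LinearMap.range ((auxP e N * T * auxP e N : H →L[ℂ] H) : H →ₗ[ℂ] H) ≤
      LinearMap.range (auxI e N) := by
    have := aux_range e N (T * auxP e N)
    rwa [← mul_assoc] at this
  rw [aux_fdet_eq hdet _ _ r1]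
  refine aux_det_matrix _ _ (auxC e N) (auxCI e N) _ ?_ r1
  ext x
  change auxP e N (T (auxP e N x)) = auxI e N (Matrix.toLin' (auxM e T N) (auxC e N x))
  rw [← auxIC e N (T _)]
  congr 1
  ext i
  rw [auxC_apply, auxP_apply, Matrix.toLin'_apply]
  simp only [map_sum, map_smul, inner_sum, inner_smul_right, Matrix.mulVec, dotProduct, auxM,
    Matrix.of_apply, auxC_apply]
  exact Finset.sum_congr rfl fun j _ => mul_comm _ _

lemma aux_trace_tend (e : HilbertBasis ℕ ℂ H) {T : H →L[ℂ] H} {u v : ℕ → H}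
    (hs : Summable (fun k => ‖u k‖ * ‖v k‖)) (hT : ∀ x, T x = ∑' k, ⟪u k, x⟫_ℂ • v k) :
    Tendsto (fun N => (auxM e T N).trace) atTop (nhds (∑' k, ⟪u k, v k⟫_ℂ)) := by
  have h1 : ∀ N, (auxM e T N).trace = ∑' k, ⟪u k, auxP e N (v k)⟫_ℂ := by
    intro N
    have hi : ∀ i, Summable fun k => ⟪e i, v k⟫_ℂ * ⟪u k, e i⟫_ℂ := by
      intro i
      have := (innerSL ℂ (e i)).summable (aux_hasSum hs (e i))
      simpa [inner_smul_right, mul_comm] using this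
    have h2 : ∀ i, ⟪e i, T (e i)⟫_ℂ = ∑' k, ⟪e i, v k⟫_ℂ * ⟪u k, e i⟫_ℂ := by
      intro i
      have := (innerSL ℂ (e i)).map_tsum (aux_hasSum hs (e i))
      rw [← hT] at this
      simpa [inner_smul_right, mul_comm] using this
    simp only [Matrix.trace, Matrix.diag, auxM, Matrix.of_apply, h2, auxP_apply, inner_sum,
      inner_smul_right]
    exact (Summable.tsum_finsetSum (s := (Finset.univ : Finset (Fin N)))
      (f := fun (i : Fin N) k => ⟪e i, v k⟫_ℂ * ⟪u k, e i⟫_ℂ) fun i _ => hi i).symm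
  simp only [h1]
  refine tendsto_tsum_of_dominated_convergence hs (fun k => ?_) (Eventually.of_forall fun N k => ?_)
  · exact Tendsto.inner tendsto_const_nhds (auxP_tendsto e (v k))
  · refine (norm_inner_le_norm _ _).trans ?_
    gcongr
    simpa using (auxP e N).le_of_opNorm_le (auxP_norm e N) (v k)

lemma aux_hs_summable (e : HilbertBasis ℕ ℂ H) {T : H →L[ℂ] H} (hT : IsTraceClass T) :
    Summable (fun i => ‖T (e i)‖ ^ 2) := by
  obtain ⟨u, v, hs, hT⟩ := hT
  have hs' := hs.mul_right ‖T.adjoint‖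
  refine summable_of_sum_le (c := ∑' k, (‖u k‖ * ‖v k‖) * ‖T.adjoint‖)
    (fun i => by positivity) fun s => ?_
  have h1 : ∀ i, HasSum (fun k => ⟪u k, e i⟫_ℂ * ⟪e i, T.adjoint (v k)⟫_ℂ)
      ((‖T (e i)‖ ^ 2 : ℝ) : ℂ) := by
    intro i
    have := ((aux_hasSum hs (e i)).hasSum).mapL (innerSL ℂ (T (e i)))
    rw [← hT] at this
    simpa [inner_smul_right, ContinuousLinearMap.adjoint_inner_right,
      inner_self_eq_norm_sq_to_K] using this
  have h2 : HasSum (fun k => ∑ i ∈ s, ⟪u k, e i⟫_ℂ * ⟪e i, T.adjoint (v k)⟫_ℂ)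
      (∑ i ∈ s, ((‖T (e i)‖ ^ 2 : ℝ) : ℂ)) := hasSum_sum fun i _ => h1 i
  have h3 : ‖∑ i ∈ s, ((‖T (e i)‖ ^ 2 : ℝ) : ℂ)‖ = ∑ i ∈ s, ‖T (e i)‖ ^ 2 := by
    rw [← Complex.ofReal_sum, Complex.norm_real, Real.norm_of_nonneg (by positivity)]
  rw [← h3, ← h2.tsum_eq]
  refine tsum_of_norm_bounded hs'.hasSum fun k => ?_
  have c1 : ∑ i ∈ s, ‖⟪u k, e i⟫_ℂ‖ ^ 2 ≤ ‖u k‖ ^ 2 := by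
    have := e.orthonormal.sum_inner_products_le (u k) (s := s)
    simpa only [norm_inner_symm] using this
  have c2 : ∑ i ∈ s, ‖⟪e i, T.adjoint (v k)⟫_ℂ‖ ^ 2 ≤ ‖T.adjoint (v k)‖ ^ 2 :=
    e.orthonormal.sum_inner_products_le _
  calc _ ≤ ∑ i ∈ s, ‖⟪u k, e i⟫_ℂ‖ * ‖⟪e i, T.adjoint (v k)⟫_ℂ‖ := by
        refine (norm_sum_le _ _).trans (le_of_eq ?_)
        simp only [norm_mul]
    _ ≤ ‖u k‖ * ‖T.adjoint (v k)‖ := by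
        refine le_of_sq_le_sq ?_ (by positivity)
        refine (Finset.sum_mul_sq_le_sq_mul_sq s _ _).trans ?_
        rw [mul_pow]
        gcongr
    _ ≤ ‖u k‖ * (‖T.adjoint‖ * ‖v k‖) := by gcongr; exact T.adjoint.le_opNorm _
    _ = _ := by ring

lemma aux_main_estimate (e : HilbertBasis ℕ ℂ H)
    {fdet : (H →L[ℂ] H) → ℂ} (hdet : IsFredholmDet fdet)
    {tr : (H →L[ℂ] H) → ℂ} (htr : IsOperatorTrace tr) {T : H →L[ℂ] H} (hT : IsTraceClass T)
    {s : ℝ} (hs : 0 < s) (hs1 : s < 1) (hHS : ∑' i, ‖T (e i)‖ ^ 2 ≤ s ^ 2) :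
    ‖fdet T * Complex.exp (-tr T) - 1‖ ≤ 3 * s := by
  have hsum := aux_hs_summable e hT
  have l1 := aux_tend_fdet hdet (fun N => aux_TC_right (aux_TC_left hT (auxP e N)) (auxP e N)) hT
    (aux_trunc_tend e hT)
  have l2 : Tendsto (fun N => (auxM e T N).trace) atTop (nhds (tr T)) := by
    obtain ⟨u, v, hs, hT⟩ := hT
    rw [htr T u v hs hT]
    exact aux_trace_tend e hs hT
  have l3 := ((l1.mul ((Complex.continuous_exp.tendsto _).comp l2.neg)).sub_const 1).norm
  refine le_of_tendsto l3 (Eventually.of_forall fun N => ?_)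
  simp only [Function.comp_apply, aux_fdet_trunc e hdet]
  refine aux_matrix_estimate _ s hs hs1 (le_trans ?_ hHS)
  rw [Finset.sum_comm]
  calc _ ≤ ∑ j : Fin N, ‖T (e j)‖ ^ 2 := by
        refine Finset.sum_le_sum fun j _ => ?_
        exact (aux_orth e N).sum_inner_products_le (T (e j)) (s := Finset.univ)
    _ = ∑ j ∈ Finset.range N, ‖T (e j)‖ ^ 2 :=
        (Finset.sum_range (fun j => ‖T (e j)‖ ^ 2)).symm
    _ ≤ _ := hsum.sum_le_tsum _ fun i _ => by positivity

end Main

/-- if `Aₙ, Bₙ` are trace class, `‖Aₙ - Bₙ‖₂ → 0`, the operators `I + Bₙ`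
are invertible with uniformly bounded inverses, and `tr((Aₙ-Bₙ)(I+Bₙ)⁻¹) → 0`, then
`det(I+Aₙ)/det(I+Bₙ) → 1`.  Here `fdet T = det(I+T)` is the Fredholm determinant and
the Hilbert–Schmidt norm is computed with respect to a Hilbert basis `e`. -/
theorem stmt_13 (e : HilbertBasis ℕ ℂ H)
    (fdet : (H →L[ℂ] H) → ℂ) (hdet : IsFredholmDet fdet)
    (tr : (H →L[ℂ] H) → ℂ) (htr : IsOperatorTrace tr)
    (A B : ℕ → H →L[ℂ] H)
    (hA : ∀ n, IsTraceClass (A n)) (hB : ∀ n, IsTraceClass (B n))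
    (hHS : Tendsto (fun n => Real.sqrt (∑' i, ‖(A n - B n) (e i)‖ ^ 2)) atTop (nhds 0))
    (Binv : ℕ → H →L[ℂ] H)
    (hBinv : ∀ n, (1 + B n) * Binv n = 1 ∧ Binv n * (1 + B n) = 1)
    (hbound : ∃ M : ℝ, ∀ n, ‖Binv n‖ ≤ M)
    (htrace : Tendsto (fun n => tr ((A n - B n) * Binv n)) atTop (nhds 0)) :
    Tendsto (fun n => fdet (A n) / fdet (B n)) atTop (nhds 1) := by
  obtain ⟨M, hM⟩ := hbound
  have hM0 : 0 ≤ M := (norm_nonneg _).trans (hM 0)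
  have hD : ∀ n, IsTraceClass (A n - B n) := fun n => by
    rw [sub_eq_add_neg]; exact aux_TC_add (hA n) (aux_TC_neg (hB n))
  set E : ℕ → H →L[ℂ] H := fun n => Binv n * (A n - B n) with hE
  have hETC : ∀ n, IsTraceClass (E n) := fun n => aux_TC_left (hD n) _
  have htrE : ∀ n, tr (E n) = tr ((A n - B n) * Binv n) := by
    intro n
    obtain ⟨u, v, hs, hT⟩ := hD n
    have w1 := aux_weight_le hs (u' := u) (v' := fun k => Binv n (v k)) (M := M) (fun k => by
      calc _ ≤ ‖u k‖ * (M * ‖v k‖) := by gcongr; exact (Binv n).le_of_opNorm_le (hM n) _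
        _ = _ := by ring)
    have hM' : ‖(Binv n).adjoint‖ ≤ M := by rw [LinearIsometryEquiv.norm_map]; exact hM n
    have w2 := aux_weight_le hs (u' := fun k => (Binv n).adjoint (u k)) (v' := v) (M := M)
      (fun k => by
      calc _ ≤ (M * ‖u k‖) * ‖v k‖ := by
            gcongr; exact (Binv n).adjoint.le_of_opNorm_le hM' _
        _ = _ := by ring)
    rw [htr _ _ _ w1.1 (aux_rep_left hs hT (Binv n)), htr _ _ _ w2.1 (aux_rep_right hT (Binv n))]
    simp only [ContinuousLinearMap.adjoint_inner_left]
  have hBne : ∀ n, fdet (B n) ≠ 0 := by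
    intro n
    have h := aux_fdet_mul e hdet (hB n) (aux_TC_neg (aux_TC_right (hB n) (Binv n)))
    have h1 := (hBinv n).1
    have h2 : B n + -(B n * Binv n) + B n * -(B n * Binv n) = 0 := by
      have : B n + -(B n * Binv n) + B n * -(B n * Binv n)
          = B n * (1 - (1 + B n) * Binv n) := by noncomm_ring
      rw [this, h1]; simp
    rw [h2, aux_fdet_zero hdet] at h
    intro h0
    rw [h0, zero_mul] at h
    exact one_ne_zero h
  have hfac : ∀ n, fdet (A n) / fdet (B n) = fdet (E n) := by
    intro n
    have h := aux_fdet_mul e hdet (hB n) (hETC n)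
    have h2 : B n + E n + B n * E n = A n := by
      have : B n + E n + B n * E n = B n + ((1 + B n) * Binv n) * (A n - B n) := by
        simp only [hE]; noncomm_ring
      rw [this, (hBinv n).1]; simp
    rw [h2] at h
    rw [h, mul_div_cancel_left₀ _ (hBne n)]
  have hlim : Tendsto (fun n => fdet (E n) * Complex.exp (-tr (E n))) atTop (nhds 1) := by
    rw [Metric.tendsto_nhds]
    intro ε hε
    set s : ℝ := min (1 / 2) (ε / 4) with hsdef
    have hs : 0 < s := by positivity
    have hs1 : s < 1 := (min_le_left _ _).trans_lt (by norm_num)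
    have hs2 : 3 * s < ε := by
      have := min_le_right (1 / 2) (ε / 4)
      linarith
    have hpos : 0 < s / (M + 1) := by positivity
    filter_upwards [hHS.eventually_lt_const hpos] with n hn
    rw [dist_eq_norm]
    refine (aux_main_estimate e hdet htr (hETC n) hs hs1 ?_).trans_lt hs2
    have hsum := aux_hs_summable e (hD n)
    have hn' : ∑' i, ‖(A n - B n) (e i)‖ ^ 2 ≤ (s / (M + 1)) ^ 2 :=
      (Real.sqrt_lt' hpos).1 hn |>.le
    calc ∑' i, ‖E n (e i)‖ ^ 2 ≤ ∑' i, (M + 1) ^ 2 * ‖(A n - B n) (e i)‖ ^ 2 := by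
          refine (aux_hs_summable e (hETC n)).tsum_le_tsum (fun i => ?_) (hsum.mul_left _)
          rw [← mul_pow]
          gcongr
          exact (Binv n).le_of_opNorm_le ((hM n).trans (by linarith)) _
      _ = (M + 1) ^ 2 * ∑' i, ‖(A n - B n) (e i)‖ ^ 2 := tsum_mul_left
      _ ≤ (M + 1) ^ 2 * (s / (M + 1)) ^ 2 := by gcongr
      _ = s ^ 2 := by field_simp
  simp only [hfac]
  have hexp : Tendsto (fun n => Complex.exp (tr (E n))) atTop (nhds 1) := by
    simp only [htrE]
    simpa [Function.comp_def] using (Complex.continuous_exp.tendsto 0).comp htrace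
  have := hlim.mul hexp
  rw [mul_one] at this
  refine this.congr fun n => ?_
  rw [mul_assoc, ← Complex.exp_add]
  simp
end

section
/- Let W be a Schwartz function on ℝ. Then the double integral ∫_1^∞ ∫_1^∞ |(W(x) - W(y))/(x - y)|² dx dy is finite and bounded by ∫_{-∞}^∞ |ξ| |Ŵ(ξ)|² dξ, where Ŵ is the Fourier transform of W. -/
open MeasureTheory Set
open scoped FourierTransform
open Filter Topology


lemma lint_aux (F f : ℝ → ℝ) (l : ℝ) (hd : ∀ x, HasDerivAt F (f x) x)
    (hf : ∀ x, 0 < x → 0 ≤ f x) (hl : Tendsto F atTop (𝓝 l)) :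
    ∫⁻ x in Ioi (0:ℝ), ENNReal.ofReal (f x) = ENNReal.ofReal (l - F 0) := by
  have h1 := integrableOn_Ioi_deriv_of_nonneg' (a := 0) (fun x _ => hd x) (fun x hx => hf x hx) hl
  have h2 := integral_Ioi_of_hasDerivAt_of_nonneg' (a := 0) (fun x _ => hd x) (fun x hx => hf x hx) hl
  rw [← h2, ofReal_integral_eq_lintegral_ofReal h1]
  filter_upwards [ae_restrict_mem measurableSet_Ioi] with x hx using hf x hx

lemma exp_tendsto (h : ℝ) (hh : 0 < h) : Tendsto (fun t : ℝ => Real.exp (-(h * t))) atTop (𝓝 0) :=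
  Real.tendsto_exp_neg_atTop_nhds_zero.comp (tendsto_id.const_mul_atTop hh)

lemma lint1 (h : ℝ) (hh : 0 < h) :
    ∫⁻ t in Ioi (0:ℝ), ENNReal.ofReal (t * Real.exp (-(h * t))) = ENNReal.ofReal (1 / h ^ 2) := by
  have hh' := hh.ne'
  rw [lint_aux (fun t => -(t / h + 1 / h ^ 2) * Real.exp (-(h * t))) _ 0]
  · simp
  · intro x
    have e : HasDerivAt (fun t : ℝ => Real.exp (-(h * t))) (Real.exp (-(h * x)) * (-h)) x := by
      have := ((hasDerivAt_id x).const_mul h).neg.exp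
      simpa using this
    have p : HasDerivAt (fun t : ℝ => -(t / h + 1 / h ^ 2)) (-(1 / h)) x :=
      (((hasDerivAt_id x).div_const h).add_const _).neg
    refine (p.mul e).congr_deriv ?_
    field_simp
    ring
  · intro x hx; positivity
  · have h1 := exp_tendsto h hh
    have h2 : Tendsto (fun t : ℝ => (h * t) * Real.exp (-(h * t))) atTop (𝓝 0) := by
      have := (Real.tendsto_pow_mul_exp_neg_atTop_nhds_zero 1).comp (tendsto_id.const_mul_atTop hh)
      simpa [Function.comp_def] using this
    have := (h2.const_mul (-(1/h^2))).add (h1.const_mul (-(1/h^2)))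
    simp only [mul_zero, add_zero] at this
    refine this.congr fun t => ?_
    field_simp
    ring

lemma lint2 (a t : ℝ) (ha : 0 < a) (ht : 0 < t) :
    ∫⁻ h in Ioi (0:ℝ), ENNReal.ofReal (Real.exp (-(t * h)) * Real.sin (a * h) ^ 2)
      = ENNReal.ofReal (2 * a ^ 2 / (t * (t ^ 2 + 4 * a ^ 2))) := by
  have hp : t ^ 2 + 4 * a ^ 2 ≠ 0 := by positivity
  rw [lint_aux (fun h => Real.exp (-(t * h)) * (-(1 / (2 * t)) - (-t * Real.cos (2 * a * h)
    + 2 * a * Real.sin (2 * a * h)) / (2 * (t ^ 2 + 4 * a ^ 2)))) _ 0]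
  · congr 1
    simp
    field_simp
    ring
  · intro x
    have e : HasDerivAt (fun h : ℝ => Real.exp (-(t * h))) (Real.exp (-(t * x)) * (-t)) x := by
      have := ((hasDerivAt_id x).const_mul t).neg.exp
      simpa using this
    have l : HasDerivAt (fun h : ℝ => 2 * a * h) (2 * a) x := by
      simpa using (hasDerivAt_id x).const_mul (2 * a)
    have := e.mul (((((l.cos.const_mul (-t)).add (l.sin.const_mul (2 * a))).div_const
      (2 * (t ^ 2 + 4 * a ^ 2))).const_sub (-(1 / (2 * t)))))
    refine this.congr_deriv ?_
    have hc : Real.cos (2 * a * x) = 1 - 2 * Real.sin (a * x) ^ 2 := by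
      rw [mul_assoc, Real.cos_two_mul, Real.cos_sq']; ring
    simp only [Pi.add_apply]
    rw [hc]
    field_simp
    ring
  · intro x hx; positivity
  · have h1 := exp_tendsto t ht
    refine bdd_le_mul_tendsto_zero' (1 / (2*t) + (t + 2 * a) / (2 * (t ^ 2 + 4 * a ^ 2))) ?_ h1 |>.congr (fun h => mul_comm _ _)
    refine Eventually.of_forall fun x => ?_
    refine (abs_sub _ _).trans ?_
    rw [abs_neg, abs_of_pos (show 0 < 1 / (2 * t) by positivity), abs_div,
      abs_of_pos (show 0 < 2 * (t ^ 2 + 4 * a ^ 2) by positivity)]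
    gcongr
    refine (abs_add_le _ _).trans ?_
    rw [abs_mul, abs_mul, abs_neg, abs_of_pos ht, abs_of_pos (show 0 < 2 * a by positivity)]
    nlinarith [Real.abs_cos_le_one (2 * a * x), Real.abs_sin_le_one (2 * a * x)]

lemma lint3 (a : ℝ) (ha : 0 < a) :
    ∫⁻ t in Ioi (0:ℝ), ENNReal.ofReal (2 * a ^ 2 / (t ^ 2 + 4 * a ^ 2))
      = ENNReal.ofReal (a * Real.pi / 2) := by
  rw [lint_aux (fun t => a * Real.arctan (t / (2 * a))) _ (a * (Real.pi / 2))]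
  · simp; congr 1; ring
  · intro x
    have := (((hasDerivAt_id x).div_const (2 * a)).arctan).const_mul a
    refine this.congr_deriv ?_
    have : 1 + (x / (2 * a)) ^ 2 ≠ 0 := by positivity
    simp only [id]
    field_simp
    ring
  · intro x hx; positivity
  · refine Tendsto.const_mul a ?_
    exact (tendsto_nhds_of_tendsto_nhdsWithin Real.tendsto_arctan_atTop).comp (tendsto_id.atTop_div_const (by positivity))

lemma lint4 (a : ℝ) (ha : 0 < a) :
    ∫⁻ h in Ioi (0:ℝ), ENNReal.ofReal (Real.sin (a * h) ^ 2 / h ^ 2)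
      = ENNReal.ofReal (a * Real.pi / 2) := by
  rw [← lint3 a ha]
  calc _ = ∫⁻ h in Ioi (0:ℝ), ∫⁻ t in Ioi (0:ℝ),
        ENNReal.ofReal (t * Real.exp (-(h * t)) * Real.sin (a * h) ^ 2) := by
        refine setLIntegral_congr_fun measurableSet_Ioi fun h hh => ?_
        have : ∀ t : ℝ, ENNReal.ofReal (t * Real.exp (-(h * t)) * Real.sin (a * h) ^ 2)
          = ENNReal.ofReal (t * Real.exp (-(h * t))) * ENNReal.ofReal (Real.sin (a * h) ^ 2) :=
          fun t => ENNReal.ofReal_mul' (by positivity)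
        simp only [this]
        rw [lintegral_mul_const _ (by fun_prop), lint1 h hh, ← ENNReal.ofReal_mul (by positivity)]
        congr 1; ring
    _ = ∫⁻ t in Ioi (0:ℝ), ∫⁻ h in Ioi (0:ℝ),
        ENNReal.ofReal (t * Real.exp (-(h * t)) * Real.sin (a * h) ^ 2) := by
        apply lintegral_lintegral_swap
        apply Measurable.aemeasurable
        simp only [Function.uncurry_def]
        fun_prop
    _ = _ := by
        refine setLIntegral_congr_fun measurableSet_Ioi fun t ht => ?_
        have ht : 0 < t := ht
        have : ∀ h : ℝ, ENNReal.ofReal (t * Real.exp (-(h * t)) * Real.sin (a * h) ^ 2)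
          = ENNReal.ofReal t * ENNReal.ofReal (Real.exp (-(t * h)) * Real.sin (a * h) ^ 2) :=
          fun h => by rw [← ENNReal.ofReal_mul ht.le, mul_comm h t, mul_assoc]
        simp only [this]
        rw [lintegral_const_mul _ (by fun_prop), lint2 a t ha ht, ← ENNReal.ofReal_mul ht.le]
        congr 1
        field_simp

lemma lint5 (a : ℝ) :
    ∫⁻ h : ℝ, ENNReal.ofReal (Real.sin (a * h) ^ 2 / h ^ 2)
      = ENNReal.ofReal (|a| * Real.pi) := by
  rcases eq_or_ne a 0 with rfl | h0
  · simp
  have e : ∀ h : ℝ, Real.sin (a * h) ^ 2 / h ^ 2 = Real.sin (|a| * h) ^ 2 / h ^ 2 := by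
    intro h
    rcases abs_choice a with h | h <;> rw [h]
    simp
  simp only [e]
  have ha : 0 < |a| := abs_pos.2 h0
  rw [← lintegral_add_compl _ (measurableSet_Ioi (a := (0:ℝ))), lint4 _ ha, compl_Ioi,
    ← setLIntegral_congr Iio_ae_eq_Iic]
  have := (Measure.measurePreserving_neg (volume : Measure ℝ)).setLIntegral_comp_preimage
    (measurableSet_Ioi (a := (0:ℝ))) (f := fun h : ℝ =>
      ENNReal.ofReal (Real.sin (|a| * h) ^ 2 / h ^ 2)) (by fun_prop)
  simp only [neg_preimage, neg_Ioi, neg_zero, mul_neg, Real.sin_neg, even_two,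
    Even.neg_pow] at this
  rw [this, lint4 _ ha, ← ENNReal.ofReal_add (by positivity) (by positivity)]
  congr 1; ring

lemma planch (W : SchwartzMap ℝ ℂ) (h : ℝ) :
    ∫⁻ x : ℝ, ENNReal.ofReal (‖W x - W (x + h)‖ ^ 2)
      = ∫⁻ ξ : ℝ, ENNReal.ofReal (‖𝓕 W ξ‖ ^ 2) *
          ENNReal.ofReal (4 * Real.sin (Real.pi * ξ * h) ^ 2) := by
  set G : SchwartzMap ℝ ℂ := W - W.compSubConstCLM ℂ (-h) with hG
  have hGx : ∀ x, G x = W x - W (x + h) := by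
    intro x; simp [hG]
  have hF : ∀ ξ, 𝓕 G ξ = (1 - (𝐞 (h * ξ) : ℂ)) * 𝓕 W ξ := by
    intro ξ
    have h1 : 𝓕 G = 𝓕 W - 𝓕 (W.compSubConstCLM ℂ (-h)) :=
      (SchwartzMap.fourierTransformCLM ℂ).map_sub _ _
    have h2 : 𝓕 (W.compSubConstCLM ℂ (-h)) ξ = 𝐞 (h * ξ) • 𝓕 W ξ := by
      rw [SchwartzMap.fourier_coe, SchwartzMap.fourier_coe, Real.fourier_real_eq,
        Real.fourier_real_eq, Circle.smul_def (𝐞 (h * ξ)), ← integral_smul,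
        ← integral_add_right_eq_self (fun v : ℝ => (𝐞 (h * ξ) : ℂ) • 𝐞 (-(v * ξ)) • W v) h]
      congr 1
      ext v
      rw [SchwartzMap.compSubConstCLM_apply, sub_neg_eq_add, ← Circle.smul_def, smul_smul, ← AddChar.map_add_eq_mul]
      congr 2
      ring
    rw [h1, sub_apply, h2, Circle.smul_def, smul_eq_mul]
    ring
  have hn : ∀ θ : ℝ, ‖1 - (𝐞 θ : ℂ)‖ ^ 2 = 4 * Real.sin (Real.pi * θ) ^ 2 := by
    intro θ
    rw [Real.fourierChar_apply, ← Complex.normSq_eq_norm_sq, Complex.normSq_apply]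
    simp only [Complex.sub_re, Complex.sub_im, Complex.exp_ofReal_mul_I_re,
      Complex.exp_ofReal_mul_I_im, Complex.one_re, Complex.one_im]
    have e : 2 * Real.pi * θ = 2 * (Real.pi * θ) := by ring
    rw [e, Real.cos_two_mul, Real.sin_two_mul]
    nlinarith [Real.sin_sq_add_cos_sq (Real.pi * θ), Real.cos_sq' (Real.pi * θ)]
  have hint : ∀ H : SchwartzMap ℝ ℂ, Integrable (fun x => ‖H x‖ ^ 2) := fun H =>
    (H.memLp 2 volume).integrable_norm_pow (by norm_num)
  have key := SchwartzMap.integral_norm_sq_fourier G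
  have := congrArg ENNReal.ofReal key
  rw [ofReal_integral_eq_lintegral_ofReal (hint _) (ae_of_all _ fun _ => by positivity),
    ofReal_integral_eq_lintegral_ofReal (hint _) (ae_of_all _ fun _ => by positivity)] at this
  simp only [hGx] at this
  rw [← this]
  refine lintegral_congr fun ξ => ?_
  rw [hF, norm_mul, mul_pow, hn, ← ENNReal.ofReal_mul (by positivity)]
  congr 1
  rw [mul_comm h ξ, ← mul_assoc]
  ring

lemma full_bound (W : SchwartzMap ℝ ℂ) :
    ∫⁻ p : ℝ × ℝ, ENNReal.ofReal (‖(W p.1 - W p.2) / (p.1 - p.2)‖ ^ 2)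
      = ∫⁻ ξ : ℝ, ENNReal.ofReal (4 * Real.pi ^ 2 * (|ξ| * ‖𝓕 W ξ‖ ^ 2)) := by
  have mW : Measurable W := W.continuous.measurable
  have mF : Measurable (fun ξ => 𝓕 W ξ) := (𝓕 W).continuous.measurable
  rw [Measure.volume_eq_prod, lintegral_prod _ (by fun_prop)]
  calc _ = ∫⁻ x : ℝ, ∫⁻ h : ℝ,
        ENNReal.ofReal (‖W x - W (x + h)‖ ^ 2) * ENNReal.ofReal (1 / h ^ 2) := by
        refine lintegral_congr fun x => ?_
        rw [← lintegral_add_left_eq_self _ x]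
        refine lintegral_congr fun h => ?_
        rw [← ENNReal.ofReal_mul (by positivity), norm_div, div_pow]
        congr 1
        have : ((x : ℂ) - ((x + h : ℝ) : ℂ)) = ((-h : ℝ) : ℂ) := by push_cast; ring
        rw [this, Complex.norm_real, Real.norm_eq_abs, sq_abs, neg_sq]
        ring
    _ = ∫⁻ h : ℝ, ∫⁻ x : ℝ,
        ENNReal.ofReal (‖W x - W (x + h)‖ ^ 2) * ENNReal.ofReal (1 / h ^ 2) := by
        apply lintegral_lintegral_swap
        apply Measurable.aemeasurable
        simp only [Function.uncurry_def]
        fun_prop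
    _ = ∫⁻ h : ℝ, ∫⁻ ξ : ℝ, ENNReal.ofReal (‖𝓕 W ξ‖ ^ 2) *
          (ENNReal.ofReal 4 * ENNReal.ofReal (Real.sin (Real.pi * ξ * h) ^ 2 / h ^ 2)) := by
        refine lintegral_congr fun h => ?_
        rw [lintegral_mul_const _ (by fun_prop), planch, ← lintegral_mul_const _ (by fun_prop)]
        refine lintegral_congr fun ξ => ?_
        iterate 4 rw [← ENNReal.ofReal_mul (by positivity)]
        congr 1
        ring
    _ = ∫⁻ ξ : ℝ, ∫⁻ h : ℝ, ENNReal.ofReal (‖𝓕 W ξ‖ ^ 2) *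
          (ENNReal.ofReal 4 * ENNReal.ofReal (Real.sin (Real.pi * ξ * h) ^ 2 / h ^ 2)) := by
        apply lintegral_lintegral_swap
        apply Measurable.aemeasurable
        simp only [Function.uncurry_def]
        fun_prop
    _ = _ := by
        refine lintegral_congr fun ξ => ?_
        rw [lintegral_const_mul _ (by fun_prop), lintegral_const_mul _ (by fun_prop), lint5,
          ← ENNReal.ofReal_mul (by positivity), ← ENNReal.ofReal_mul (by positivity)]
        congr 1
        rw [abs_mul, abs_of_pos Real.pi_pos]
        ring

lemma rhs_eq (W : SchwartzMap ℝ ℂ) :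
    ∫ ξ : ℝ, |ξ| * ‖∫ x : ℝ, W x * Complex.exp (-(Complex.I * ξ * x))‖ ^ 2
      = ∫ ξ : ℝ, 4 * Real.pi ^ 2 * (|ξ| * ‖𝓕 W ξ‖ ^ 2) := by
  have hp := Real.pi_pos
  have := Measure.integral_comp_mul_left (fun ξ : ℝ => |ξ| *
    ‖∫ x : ℝ, W x * Complex.exp (-(Complex.I * ξ * x))‖ ^ 2) (2 * Real.pi)
  rw [abs_of_pos (by positivity), smul_eq_mul, eq_inv_mul_iff_mul_eq₀ (by positivity)] at this
  rw [← this, ← integral_const_mul]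
  congr 1
  ext ξ
  have e : ∫ x : ℝ, W x * Complex.exp (-(Complex.I * ((2 * Real.pi * ξ : ℝ) : ℂ) * x)) = 𝓕 W ξ := by
    rw [SchwartzMap.fourier_coe, Real.fourier_real_eq]
    congr 1
    ext v
    rw [Circle.smul_def, Real.fourierChar_apply, smul_eq_mul, mul_comm]
    congr 2
    push_cast
    ring
  rw [e, abs_mul, abs_of_pos (show 0 < 2 * Real.pi by positivity)]
  ring

lemma rhs_int (W : SchwartzMap ℝ ℂ) :
    Integrable (fun ξ : ℝ => 4 * Real.pi ^ 2 * (|ξ| * ‖𝓕 W ξ‖ ^ 2)) := by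
  refine Integrable.const_mul ?_ _
  obtain ⟨C, hC⟩ := (𝓕 W).decay 0 0
  have h1 := (𝓕 W).integrable_pow_mul volume 1
  refine (h1.const_mul C).mono' ?_ (ae_of_all _ fun ξ => ?_)
  · exact (continuous_abs.mul ((𝓕 W).continuous.norm.pow 2)).aestronglyMeasurable
  · have := hC.2 ξ
    simp only [pow_zero, one_mul, norm_iteratedFDeriv_zero] at this
    rw [Real.norm_of_nonneg (by positivity), pow_one, Real.norm_eq_abs]
    nlinarith [mul_le_mul_of_nonneg_left this (show 0 ≤ |ξ| * ‖𝓕 W ξ‖ by positivity)]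

theorem stmt_15 (W : SchwartzMap ℝ ℂ) :
    IntegrableOn (fun p : ℝ × ℝ => ‖(W p.1 - W p.2) / (p.1 - p.2)‖ ^ 2)
        (Ioi 1 ×ˢ Ioi 1) ∧
    (∫ p in (Ioi (1 : ℝ)) ×ˢ (Ioi (1 : ℝ)), ‖(W p.1 - W p.2) / (p.1 - p.2)‖ ^ 2)
      ≤ ∫ ξ : ℝ, |ξ| * ‖∫ x : ℝ, W x * Complex.exp (-(Complex.I * ξ * x))‖ ^ 2 := by
  have mW : Measurable W := W.continuous.measurable
  have hb := full_bound W
  rw [← ofReal_integral_eq_lintegral_ofReal (rhs_int W) (ae_of_all _ fun _ => by positivity)] at hb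
  have hI : Integrable (fun p : ℝ × ℝ => ‖(W p.1 - W p.2) / (p.1 - p.2)‖ ^ 2) := by
    refine ⟨Measurable.aestronglyMeasurable (by fun_prop), ?_⟩
    rw [hasFiniteIntegral_iff_ofReal (ae_of_all _ fun _ => by positivity), hb]
    exact ENNReal.ofReal_lt_top
  refine ⟨hI.integrableOn, ?_⟩
  rw [rhs_eq]
  refine (setIntegral_le_integral hI (ae_of_all _ fun _ => by positivity)).trans ?_
  rw [integral_eq_lintegral_of_nonneg_ae (ae_of_all _ fun _ => by positivity) hI.1, hb,
    ENNReal.toReal_ofReal]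
  exact integral_nonneg fun _ => by positivity
end
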